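/- arXiv:1106.5929 — 6 statements merged into one kernel-verified Lean document; each statement's English description precedes it below -/
import Mathlib

section
/- Let μ₁,…,μₙ be Borel probability measures on ℝ with finite first moments such that M(μ₁,…,μₙ) is non-empty, and let Φ : ℝⁿ → (−∞,∞] be a lower semi-continuous function satisfying Φ(s₁,…,sₙ) ≥ −K·(1+|s₁|+…+|sₙ|) on ℝⁿ for some constant K. Then the primal infimum is attained: there exists a martingale measure Q ∈ M(μ₁,…,μₙ) such that ∫ Φ dQ = inf{∫ Φ dπ : π ∈ M(μ₁,…,μₙ)}. -/
open MeasureTheory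
open scoped BigOperators ENNReal

noncomputable section

namespace MOT

/-- The positive part of an extended real, as an element of `ℝ≥0∞`. -/
def toENN (a : EReal) : ℝ≥0∞ := if a = ⊤ then ⊤ else ENNReal.ofReal a.toReal

/-- Extended integral of an `EReal`-valued function: positive part minus negative part. -/
def eInt {α : Type*} [MeasurableSpace α] (Φ : α → EReal) (π : Measure α) : EReal :=
  ((∫⁻ x, toENN (Φ x) ∂π : ℝ≥0∞) : EReal) - ((∫⁻ x, toENN (-(Φ x)) ∂π : ℝ≥0∞) : EReal)

/-- The `j`-th coordinate of `x : Fin n → ℝ` read with a natural number index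
(`0` outside of the range). -/
def coord {n : ℕ} (x : Fin n → ℝ) (j : ℕ) : ℝ := if h : j < n then x ⟨j, h⟩ else 0

/-- `π` is a (probability) transport plan with marginals `μ 0, …, μ (n-1)`,
i.e. an element of `Π(μ₁, …, μₙ)`. -/
def IsCoupling {n : ℕ} (π : Measure (Fin n → ℝ)) (μ : Fin n → Measure ℝ) : Prop :=
  IsProbabilityMeasure π ∧ ∀ i : Fin n, π.map (fun x => x i) = μ i

/-- `π` is a martingale transport plan, i.e. an element of `M(μ₁, …, μₙ)`: a coupling under
which the coordinate process is a martingale in its own filtration, expressed via bounded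
measurable functions of the first coordinates. -/
def IsMartingaleCoupling {n : ℕ} (π : Measure (Fin n → ℝ)) (μ : Fin n → Measure ℝ) : Prop :=
  IsCoupling π μ ∧
  ∀ j : ℕ, j + 1 < n →
    ∀ Δ : (Fin n → ℝ) → ℝ, Measurable Δ → (∃ C, ∀ x, |Δ x| ≤ C) →
      (∀ x y, (∀ i, i ≤ j → coord x i = coord y i) → Δ x = Δ y) →
      ∫ x, Δ x * (coord x (j + 1) - coord x j) ∂π = 0

/-- The payoff of the semi-static subhedging strategy determined by the static parts
`u i` and the delta strategies `Δ j`. -/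
def subhedge {n : ℕ} (u : Fin n → ℝ → ℝ) (Δ : ℕ → (Fin n → ℝ) → ℝ) (x : Fin n → ℝ) : ℝ :=
  (∑ i : Fin n, u i (x i)) +
    ∑ j ∈ Finset.range (n - 1), Δ j x * (coord x (j + 1) - coord x j)

/-- The delta strategies are bounded, measurable, and `Δ j` depends only on the first
`j+1` coordinates. -/
def AdmissibleDelta {n : ℕ} (Δ : ℕ → (Fin n → ℝ) → ℝ) : Prop :=
  ∀ j : ℕ, Measurable (Δ j) ∧ (∃ C, ∀ x, |Δ j x| ≤ C) ∧
    (∀ x y, (∀ i, i ≤ j → coord x i = coord y i) → Δ j x = Δ j y)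

/-- The primal value `P`: the infimum of `∫ Φ dπ` over martingale transport plans. -/
def primal {n : ℕ} (μ : Fin n → Measure ℝ) (Φ : (Fin n → ℝ) → EReal) : EReal :=
  sInf {v : EReal | ∃ π, IsMartingaleCoupling π μ ∧ v = eInt Φ π}

/-- The dual value `D`: the supremum of the prices of semi-static subhedges of `Φ`. -/
def dual {n : ℕ} (μ : Fin n → Measure ℝ) (Φ : (Fin n → ℝ) → EReal) : EReal :=
  sSup {v : EReal | ∃ (u : Fin n → ℝ → ℝ) (Δ : ℕ → (Fin n → ℝ) → ℝ),
    (∀ i, Integrable (u i) (μ i)) ∧ AdmissibleDelta Δ ∧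
    (∀ x, (subhedge u Δ x : EReal) ≤ Φ x) ∧
    v = ((∑ i : Fin n, ∫ s, u i s ∂(μ i) : ℝ) : EReal)}

end MOT

open Filter Set
open scoped Topology BoundedContinuousFunction

namespace MeasureTheory

section LowerSemicontinuity

variable {X : Type*} [TopologicalSpace X] [TopologicalSpace.PseudoMetrizableSpace X]
  [TopologicalSpace.SeparableSpace X] [MeasurableSpace X] [BorelSpace X]

/-- The integral of a nonnegative real lower semicontinuous function is lower semicontinuous in the
measure for the weak topology. -/
lemma lowerSemicontinuous_lintegral_ofReal {g : X → ℝ} (hg : LowerSemicontinuous g)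
    (hg0 : ∀ x, 0 ≤ g x) :
    LowerSemicontinuous
      fun π : ProbabilityMeasure X => ∫⁻ x, ENNReal.ofReal (g x) ∂(π : Measure X) := by
  rw [lowerSemicontinuous_iff_le_liminf]
  intro π
  have layer (ρ : ProbabilityMeasure X) : ∫⁻ x, ENNReal.ofReal (g x) ∂(ρ : Measure X)
      = ∫⁻ t in Ioi 0, (ρ : Measure X) {x | t < g x} :=
    lintegral_eq_lintegral_meas_lt _ (Eventually.of_forall hg0) hg.measurable.aemeasurable
  simp_rw [layer]
  calc ∫⁻ t in Ioi 0, (π : Measure X) {x | t < g x}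
      ≤ ∫⁻ t in Ioi 0, liminf (fun ρ : ProbabilityMeasure X => (ρ : Measure X) {x | t < g x})
          (𝓝 π) := by
        refine lintegral_mono fun t => ?_
        exact ProbabilityMeasure.le_liminf_measure_open_of_tendsto tendsto_id
          (hg.isOpen_preimage t)
    _ ≤ liminf (fun ρ : ProbabilityMeasure X => ∫⁻ t in Ioi 0, (ρ : Measure X) {x | t < g x})
          (𝓝 π) := by
        refine lintegral_liminf_le fun ρ => Antitone.measurable fun s t hst => ?_
        exact measure_mono fun x hx => lt_of_le_of_lt hst hx

/-- The integral of an extended nonnegative lower semicontinuous function is lower semicontinuous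
in the measure for the weak topology. -/
lemma lowerSemicontinuous_lintegral {G : X → ℝ≥0∞} (hG : LowerSemicontinuous G) :
    LowerSemicontinuous fun π : ProbabilityMeasure X => ∫⁻ x, G x ∂(π : Measure X) := by
  have hmono : Monotone fun (k : ℕ) x => min (G x) (k : ℝ≥0∞) := fun k l hkl x => by
    dsimp only
    gcongr
  have hmeas (k : ℕ) : Measurable fun x => min (G x) (k : ℝ≥0∞) :=
    hG.measurable.min measurable_const
  have hsup (π : ProbabilityMeasure X) : ∫⁻ x, G x ∂(π : Measure X)
      = ⨆ k : ℕ, ∫⁻ x, ENNReal.ofReal (min (G x) (k : ℝ≥0∞)).toReal ∂(π : Measure X) := by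
    have hfin (k : ℕ) (x : X) : ENNReal.ofReal (min (G x) (k : ℝ≥0∞)).toReal = min (G x) k :=
      ENNReal.ofReal_toReal (ne_top_of_le_ne_top (ENNReal.natCast_ne_top k) (min_le_right _ _))
    simp_rw [hfin]
    rw [← lintegral_iSup hmeas hmono]
    refine lintegral_congr fun x => ?_
    rw [← inf_iSup_eq, ENNReal.iSup_natCast, inf_top_eq]
  simp_rw [hsup]
  refine lowerSemicontinuous_iSup fun k => ?_
  refine lowerSemicontinuous_lintegral_ofReal ?_ fun x => ENNReal.toReal_nonneg
  have hfin (a : ℝ≥0∞) : min a (k : ℝ≥0∞) ≠ ∞ :=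
    ne_top_of_le_ne_top (ENNReal.natCast_ne_top k) (min_le_right _ _)
  have hc : Continuous fun a : ℝ≥0∞ => (min a (k : ℝ≥0∞)).toReal :=
    ENNReal.continuousOn_toReal.comp_continuous (continuous_id.min continuous_const) hfin
  refine hc.comp_lowerSemicontinuous hG fun a b hab => ?_
  exact ENNReal.toReal_mono (hfin b) (min_le_min_right _ hab)

/-- A continuous function dominated by a continuous weight of constant integral on a closed set of
measures has vanishing integral on a closed subset. -/
lemma isClosed_setOf_integral_eq_zero {S : Set (ProbabilityMeasure X)} (hS : IsClosed S)
    {h B : X → ℝ} (hh : Continuous h) (hB : Continuous B) (hhB : ∀ x, |h x| ≤ B x) {b : ℝ}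
    (hBint : ∀ π ∈ S, Integrable B (π : Measure X))
    (hBb : ∀ π ∈ S, ∫ x, B x ∂(π : Measure X) = b) :
    IsClosed {π : ProbabilityMeasure X | π ∈ S ∧ ∫ x, h x ∂(π : Measure X) = 0} := by
  have key (f : X → ℝ) (hf : Continuous f) (hfB : ∀ x, |f x| ≤ B x) (π : ProbabilityMeasure X)
      (hπ : π ∈ S) : ∫⁻ x, ENNReal.ofReal (B x + f x) ∂(π : Measure X) ≤ ENNReal.ofReal b ↔
        ∫ x, f x ∂(π : Measure X) ≤ 0 := by
    have hfi : Integrable f (π : Measure X) :=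
      (hBint π hπ).mono' hf.measurable.aestronglyMeasurable (Eventually.of_forall hfB)
    have hb : 0 ≤ b := by
      rw [← hBb π hπ]
      exact integral_nonneg fun x => (abs_nonneg _).trans (hfB x)
    have hsum : Integrable (fun x => B x + f x) (π : Measure X) := (hBint π hπ).add hfi
    rw [← ofReal_integral_eq_lintegral_ofReal hsum
      (Eventually.of_forall fun x => by
        have := neg_le_of_abs_le (hfB x)
        rw [Pi.zero_apply]
        linarith),
      ENNReal.ofReal_le_ofReal_iff hb, integral_add (hBint π hπ) hfi, hBb π hπ]
    constructor <;> intro _ <;> linarith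
  have hcl (f : X → ℝ) (hf : Continuous f) :
      IsClosed {π : ProbabilityMeasure X |
        ∫⁻ x, ENNReal.ofReal (B x + f x) ∂(π : Measure X) ≤ ENNReal.ofReal b} :=
    (lowerSemicontinuous_lintegral (ENNReal.continuous_ofReal.comp
      (hB.add hf)).lowerSemicontinuous).isClosed_preimage _
  convert! hS.inter ((hcl h hh).inter (hcl (fun x => - h x) hh.neg)) using 1
  ext π
  simp only [mem_ofPred_eq, mem_inter_iff]
  refine and_congr_right fun hπ => ?_
  rw [key h hh hhB π hπ, key (fun x => - h x) hh.neg (by simpa using hhB) π hπ, integral_neg]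
  constructor
  · intro h0; simp [h0]
  · intro h0; linarith [h0.1, h0.2]

end LowerSemicontinuity

/-- If `h` is orthogonal to `g ∘ r` for every bounded continuous `g`, then also for every bounded
measurable `g`. -/
lemma integral_comp_mul_eq_zero_of_forall_boundedContinuous {X Y : Type*} [MeasurableSpace X]
    [TopologicalSpace Y] [HasOuterApproxClosed Y] [MeasurableSpace Y] [BorelSpace Y]
    {Q : Measure X} {r : X → Y} (hr : Measurable r) {h : X → ℝ} (hm : Measurable h)
    (hh : Integrable h Q) (H : ∀ g : Y →ᵇ ℝ, ∫ x, g (r x) * h x ∂Q = 0)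
    {g : Y → ℝ} (hg : Measurable g) {C : ℝ} (hC : ∀ y, |g y| ≤ C) :
    ∫ x, g (r x) * h x ∂Q = 0 := by
  let ρ : (X → ℝ) → Measure Y := fun f => (Q.withDensity fun x => ENNReal.ofReal (f x)).map r
  have hρ (f : X → ℝ) (hf : Measurable f) (u : Y → ℝ) (hu : Measurable u) :
      ∫ y, u y ∂(ρ f) = ∫ x, u (r x) * max (f x) 0 ∂Q := by
    rw [integral_map hr.aemeasurable hu.aestronglyMeasurable,
      integral_withDensity_eq_integral_toReal_smul hf.ennreal_ofReal
        (Eventually.of_forall fun x => ENNReal.ofReal_lt_top)]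
    simp [ENNReal.toReal_ofReal', mul_comm]
  have hsub (u : Y → ℝ) (hu : Measurable u) (c : ℝ) (hc : ∀ y, |u y| ≤ c) :
      ∫ y, u y ∂(ρ h) - ∫ y, u y ∂(ρ fun x => - h x) = ∫ x, u (r x) * h x ∂Q := by
    rw [hρ h hm u hu, hρ (fun x => - h x) hm.neg u hu, ← integral_sub]
    · refine integral_congr_ae (Eventually.of_forall fun x => ?_)
      simp only
      rw [← mul_sub]
      congr 1
      rcases le_total (h x) 0 with h0 | h0
      · rw [max_eq_right h0, max_eq_left (by linarith)]; ring
      · rw [max_eq_left h0, max_eq_right (by linarith)]; ring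
    · exact hh.pos_part.bdd_mul (hu.comp hr).aestronglyMeasurable
        (Eventually.of_forall fun x => hc (r x))
    · exact hh.neg.pos_part.bdd_mul (hu.comp hr).aestronglyMeasurable
        (Eventually.of_forall fun x => hc (r x))
  have : IsFiniteMeasure (Q.withDensity fun x => ENNReal.ofReal (h x)) :=
    isFiniteMeasure_withDensity_ofReal hh.2
  have : IsFiniteMeasure (Q.withDensity fun x => ENNReal.ofReal (- h x)) :=
    isFiniteMeasure_withDensity_ofReal hh.neg.2
  have heq : ρ h = ρ fun x => - h x := by
    refine ext_of_forall_integral_eq_of_IsFiniteMeasure fun u => ?_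
    rw [← sub_eq_zero, hsub u u.continuous.measurable ‖u‖ u.norm_coe_le_norm, H u]
  rw [← hsub g hg C hC, heq, sub_self]

end MeasureTheory

namespace MOT

variable {n : ℕ} {μ : Fin n → Measure ℝ}

lemma isCompact_setOf_isCoupling (hprob : ∀ i, IsProbabilityMeasure (μ i)) :
    IsCompact {π : ProbabilityMeasure (Fin n → ℝ) | IsCoupling (π : Measure (Fin n → ℝ)) μ} := by
  set S := {π : ProbabilityMeasure (Fin n → ℝ) | IsCoupling (π : Measure (Fin n → ℝ)) μ}
  have hclosed : IsClosed S := by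
    let ν : Fin n → ProbabilityMeasure ℝ := fun i => ⟨μ i, hprob i⟩
    let p : Fin n → ProbabilityMeasure (Fin n → ℝ) → ProbabilityMeasure ℝ :=
      fun i π => π.map (f := fun x => x i) (measurable_pi_apply i).aemeasurable
    have hp (i : Fin n) : Continuous (p i) :=
      ProbabilityMeasure.continuous_map (f := fun x : Fin n → ℝ => x i) (continuous_apply i)
    have : S = ⋂ i, {π | p i π = ν i} := by
      ext π
      rw [mem_iInter]
      exact ⟨fun h i => Subtype.ext (h.2 i), fun h => ⟨π.2, fun i => congrArg Subtype.val (h i)⟩⟩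
    rw [this]
    exact isClosed_iInter fun i => isClosed_eq (hp i) continuous_const
  rw [← hclosed.closure_eq]
  refine isCompact_closure_of_isTightMeasureSet ?_
  rw [isTightMeasureSet_iff_exists_isCompact_measure_compl_le]
  intro ε hε
  obtain ⟨δ, hδ, hδε⟩ := ENNReal.exists_pos_sum_of_countable hε.ne' (Fin n)
  have hK (i : Fin n) : ∃ K : Set ℝ, IsCompact K ∧ μ i Kᶜ ≤ δ i := by
    obtain ⟨K, hK, hKμ⟩ := isTightMeasureSet_iff_exists_isCompact_measure_compl_le.1
      (isTightMeasureSet_singleton (μ := μ i)) (δ i) (by exact_mod_cast hδ i)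
    exact ⟨K, hK, hKμ _ rfl⟩
  choose K hKc hKμ using hK
  refine ⟨Set.pi univ K, isCompact_univ_pi hKc, ?_⟩
  rintro _ ⟨π, hπ, rfl⟩
  calc (π : Measure (Fin n → ℝ)) (Set.pi univ K)ᶜ
      ≤ (π : Measure (Fin n → ℝ)) (⋃ i, (fun x : Fin n → ℝ => x i) ⁻¹' (K i)ᶜ) := by
        refine measure_mono fun x hx => ?_
        simpa [Set.mem_pi] using hx
    _ ≤ ∑' i, (π : Measure (Fin n → ℝ)) ((fun x : Fin n → ℝ => x i) ⁻¹' (K i)ᶜ) :=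
        measure_iUnion_le _
    _ ≤ ∑' i, (δ i : ℝ≥0∞) := by
        refine ENNReal.tsum_le_tsum fun i => ?_
        rw [← Measure.map_apply (measurable_pi_apply i) (hKc i).measurableSet.compl, hπ.2 i]
        exact hKμ i
    _ ≤ ε := hδε.le

lemma IsCoupling.integrable_weight {π : Measure (Fin n → ℝ)} (hπ : IsCoupling π μ)
    (hmom : ∀ i, Integrable (fun s : ℝ => s) (μ i)) :
    Integrable (fun x : Fin n → ℝ => 1 + ∑ i, |x i|) π ∧
      ∫ x, (1 + ∑ i, |x i|) ∂π = 1 + ∑ i, ∫ s, |s| ∂(μ i) := by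
  have := hπ.1
  have hi (i : Fin n) : Integrable (fun x : Fin n → ℝ => |x i|) π := by
    have h := (hmom i).abs
    rw [← hπ.2 i] at h
    exact h.comp_measurable (measurable_pi_apply i)
  have hsum : Integrable (fun x : Fin n → ℝ => ∑ i, |x i|) π :=
    integrable_finsetSum _ fun i _ => hi i
  refine ⟨(integrable_const 1).add hsum, ?_⟩
  rw [integral_add (integrable_const 1) hsum, integral_finsetSum _ fun i _ => hi i]
  congr 1
  · simp
  · refine Finset.sum_congr rfl fun i _ => ?_
    rw [← hπ.2 i]
    exact (integral_map (φ := fun x : Fin n → ℝ => x i) (f := fun s : ℝ => |s|)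
      (measurable_pi_apply i).aemeasurable continuous_abs.aestronglyMeasurable).symm

lemma continuous_coord (j : ℕ) : Continuous fun x : Fin n → ℝ => coord x j := by
  unfold coord
  split
  · exact continuous_apply _
  · exact continuous_const

lemma abs_coord_le (x : Fin n → ℝ) (j : ℕ) : |coord x j| ≤ 1 + ∑ i, |x i| := by
  unfold coord
  split
  · next h =>
    have := Finset.single_le_sum (f := fun i => |x i|) (fun i _ => abs_nonneg _)
      (Finset.mem_univ (⟨j, h⟩ : Fin n))
    linarith
  · have : 0 ≤ ∑ i, |x i| := Finset.sum_nonneg fun i _ => abs_nonneg _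
    simp only [abs_zero]
    linarith

lemma abs_coord_succ_sub_le (x : Fin n → ℝ) (j : ℕ) :
    |coord x (j + 1) - coord x j| ≤ 2 * (1 + ∑ i, |x i|) := by
  have := abs_sub (coord x (j + 1)) (coord x j)
  linarith [abs_coord_le x (j + 1), abs_coord_le x j]

/-- Replace the coordinates of `x` after the `j`-th one by `0`. -/
def truncate (j : ℕ) (x : Fin n → ℝ) : Fin n → ℝ := fun i => if (i : ℕ) ≤ j then x i else 0

lemma continuous_truncate (j : ℕ) : Continuous (truncate j : (Fin n → ℝ) → Fin n → ℝ) := by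
  refine continuous_pi fun i => ?_
  unfold truncate
  split
  · exact continuous_apply i
  · exact continuous_const

lemma coord_truncate (x : Fin n → ℝ) {i j : ℕ} (hij : i ≤ j) :
    coord (truncate j x) i = coord x i := by
  simp [coord, truncate, hij]

lemma truncate_congr {j : ℕ} {x y : Fin n → ℝ} (h : ∀ i, i ≤ j → coord x i = coord y i) :
    truncate j x = truncate j y := by
  ext i
  unfold truncate
  split
  · next hi => simpa [coord] using h i hi
  · rfl

/-- The martingale property only has to be tested on bounded continuous functions of the past. -/
lemma isMartingaleCoupling_iff_boundedContinuous {π : Measure (Fin n → ℝ)}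
    (hmom : ∀ i, Integrable (fun s : ℝ => s) (μ i)) :
    IsMartingaleCoupling π μ ↔ IsCoupling π μ ∧ ∀ j : ℕ, j + 1 < n → ∀ g : (Fin n → ℝ) →ᵇ ℝ,
      ∫ x, g (truncate j x) * (coord x (j + 1) - coord x j) ∂π = 0 := by
  refine and_congr_right fun hπ => ⟨fun h j hj g => ?_, fun h j hj Δ hΔ ⟨C, hC⟩ hdep => ?_⟩
  · exact h j hj (fun x => g (truncate j x))
      (g.continuous.comp (continuous_truncate j)).measurable
      ⟨‖g‖, fun x => g.norm_coe_le_norm _⟩ fun x y hxy => by rw [truncate_congr hxy]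
  · have hcont : Continuous fun x : Fin n → ℝ => coord x (j + 1) - coord x j :=
      (continuous_coord _).sub (continuous_coord _)
    have hint : Integrable (fun x : Fin n → ℝ => coord x (j + 1) - coord x j) π :=
      ((hπ.integrable_weight hmom).1.const_mul 2).mono' hcont.measurable.aestronglyMeasurable
        (Eventually.of_forall fun x => abs_coord_succ_sub_le x j)
    rw [← integral_comp_mul_eq_zero_of_forall_boundedContinuous
      (continuous_truncate j).measurable hcont.measurable hint (h j hj) hΔ hC]
    refine integral_congr_ae (Eventually.of_forall fun x => ?_)
    dsimp only
    rw [hdep x (truncate j x) fun i hi => (coord_truncate x hi).symm]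

lemma isCompact_setOf_isMartingaleCoupling (hprob : ∀ i, IsProbabilityMeasure (μ i))
    (hmom : ∀ i, Integrable (fun s : ℝ => s) (μ i)) :
    IsCompact {π : ProbabilityMeasure (Fin n → ℝ) |
      IsMartingaleCoupling (π : Measure (Fin n → ℝ)) μ} := by
  have hS := isCompact_setOf_isCoupling hprob
  have hclosed : IsClosed (⋂ (j : ℕ) (_ : j + 1 < n) (g : (Fin n → ℝ) →ᵇ ℝ),
      {π : ProbabilityMeasure (Fin n → ℝ) |
        π ∈ {π : ProbabilityMeasure (Fin n → ℝ) | IsCoupling (π : Measure (Fin n → ℝ)) μ} ∧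
        ∫ x, g (truncate j x) * (coord x (j + 1) - coord x j) ∂(π : Measure (Fin n → ℝ)) = 0}) := by
    refine isClosed_iInter fun j => isClosed_iInter fun hj => isClosed_iInter fun g => ?_
    refine isClosed_setOf_integral_eq_zero hS.isClosed
      (B := fun x => ‖g‖ * (2 * (1 + ∑ i, |x i|)))
      (b := ‖g‖ * (2 * (1 + ∑ i, ∫ s, |s| ∂(μ i)))) ?_ (by fun_prop) ?_ ?_ ?_
    · exact (g.continuous.comp (continuous_truncate j)).mul
        ((continuous_coord _).sub (continuous_coord _))
    · intro x
      rw [abs_mul]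
      exact mul_le_mul (g.norm_coe_le_norm _) (abs_coord_succ_sub_le x j) (abs_nonneg _)
        (norm_nonneg _)
    · intro π hπ
      exact ((hπ.integrable_weight hmom).1.const_mul 2).const_mul _
    · intro π hπ
      rw [integral_const_mul, integral_const_mul, (hπ.integrable_weight hmom).2]
  convert! hS.inter_right hclosed using 1
  ext π
  simp only [mem_ofPred_eq, mem_inter_iff, mem_iInter,
    isMartingaleCoupling_iff_boundedContinuous hmom]
  exact ⟨fun h => ⟨h.1, fun j hj g => ⟨h.1, h.2 j hj g⟩⟩,
    fun h => ⟨h.1, fun j hj g => (h.2 j hj g).2⟩⟩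

lemma toENN_eq_toENNReal (a : EReal) : toENN a = a.toENNReal := rfl

/-- For a measurable function bounded below by `-L` with `L` nonnegative and integrable, the
extended integral is the integral of the nonnegative function `Φ + L` minus that of `L`. -/
lemma eInt_eq_lintegral_add_sub {α : Type*} [MeasurableSpace α] {π : Measure α} {Φ : α → EReal}
    (hΦ : Measurable Φ) {L : α → ℝ} (hL : Integrable L π) (hLm : Measurable L)
    (hL0 : ∀ x, 0 ≤ L x) (hb : ∀ x, ((-L x : ℝ) : EReal) ≤ Φ x) :
    eInt Φ π = ((∫⁻ x, (Φ x + (L x : EReal)).toENNReal ∂π : ℝ≥0∞) : EReal)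
      - ((∫ x, L x ∂π : ℝ) : EReal) := by
  have hpt (x : α) : (Φ x).toENNReal + ENNReal.ofReal (L x)
      = (Φ x + (L x : EReal)).toENNReal + (-Φ x).toENNReal := by
    have hx := hb x
    induction hΦx : Φ x with
    | bot => rw [hΦx] at hx; simp at hx
    | top => simp
    | coe a =>
      rw [hΦx, EReal.coe_le_coe_iff] at hx
      rw [← EReal.coe_add, ← EReal.coe_neg]
      simp only [EReal.toENNReal_of_ne_top (EReal.coe_ne_top _), EReal.toReal_coe]
      have := hL0 x
      rcases le_total a 0 with h | h
      · rw [ENNReal.ofReal_of_nonpos h, ← ENNReal.ofReal_add (by linarith) (by linarith)]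
        simp
      · rw [ENNReal.ofReal_of_nonpos (p := -a) (by linarith), ← ENNReal.ofReal_add h this]
        simp
  have hLfin : ∫⁻ x, ENNReal.ofReal (L x) ∂π = ENNReal.ofReal (∫ x, L x ∂π) :=
    (ofReal_integral_eq_lintegral_ofReal hL (Eventually.of_forall hL0)).symm
  have hneg : ∫⁻ x, (-Φ x).toENNReal ∂π ≠ ∞ := by
    refine ne_top_of_le_ne_top (b := ∫⁻ x, ENNReal.ofReal (L x) ∂π) ?_
      (lintegral_mono fun x => ?_)
    · rw [hLfin]; exact ENNReal.ofReal_ne_top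
    · have h : -Φ x ≤ (L x : EReal) := by
        rw [EReal.neg_le]; simpa using hb x
      simpa [EReal.toENNReal_of_ne_top (EReal.coe_ne_top _)] using EReal.toENNReal_le_toENNReal h
  have hm : Measurable fun x => (-Φ x).toENNReal := hΦ.neg.ereal_toENNReal
  have hI : ∫⁻ x, (Φ x).toENNReal ∂π + ENNReal.ofReal (∫ x, L x ∂π)
      = ∫⁻ x, (Φ x + (L x : EReal)).toENNReal ∂π + ∫⁻ x, (-Φ x).toENNReal ∂π := by
    rw [← hLfin, ← lintegral_add_right _ hLm.ennreal_ofReal, lintegral_congr hpt,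
      lintegral_add_right _ hm]
  unfold eInt
  simp_rw [toENN_eq_toENNReal]
  have hc0 : 0 ≤ ∫ x, L x ∂π := integral_nonneg hL0
  generalize ∫⁻ x, (Φ x).toENNReal ∂π = p at *
  generalize ∫⁻ x, (-Φ x).toENNReal ∂π = q at *
  generalize ∫⁻ x, (Φ x + (L x : EReal)).toENNReal ∂π = w at *
  generalize ∫ x, L x ∂π = c at *
  lift q to NNReal using hneg
  lift c to NNReal using hc0
  rw [ENNReal.ofReal_coe_nnreal] at hI
  have hq : ((q : ℝ≥0∞) : EReal) = ((q : ℝ) : EReal) := rfl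
  rw [hq]
  induction p with
  | top =>
    have : w = ⊤ := by simpa using hI.symm
    simp [this]
  | coe p =>
    have hw : w ≠ ⊤ := by
      rintro rfl
      simp [← ENNReal.coe_add] at hI
    lift w to NNReal using hw
    norm_cast at hI
    have hI' : (p : ℝ) + c = w + q := by exact_mod_cast hI
    change ((p : ℝ) : EReal) - ((q : ℝ) : EReal) = ((w : ℝ) : EReal) - ((c : ℝ) : EReal)
    norm_cast
    linarith

end MOT

/-- **Theorem 1 (primal attainment).** Under the hypotheses of the duality theorem, the
primal infimum is attained: there is a martingale transport plan `Q ∈ M(μ₁, …, μₙ)` with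
`∫ Φ dQ = inf {∫ Φ dπ : π ∈ M(μ₁, …, μₙ)}`. -/
theorem primal_attained {n : ℕ} (μ : Fin n → Measure ℝ)
    (hprob : ∀ i, IsProbabilityMeasure (μ i))
    (hmom : ∀ i, Integrable (fun s : ℝ => s) (μ i))
    (hne : ∃ π : Measure (Fin n → ℝ), MOT.IsMartingaleCoupling π μ)
    (Φ : (Fin n → ℝ) → EReal) (hlsc : LowerSemicontinuous Φ)
    (K : ℝ) (hK : ∀ x : Fin n → ℝ, ((-(K * (1 + ∑ i, |x i|)) : ℝ) : EReal) ≤ Φ x) :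
    ∃ Q : Measure (Fin n → ℝ), MOT.IsMartingaleCoupling Q μ ∧
      MOT.eInt Φ Q = MOT.primal μ Φ := by
  set L : (Fin n → ℝ) → ℝ := fun x => |K| * (1 + ∑ i, |x i|) with hL
  have hW (x : Fin n → ℝ) : 0 ≤ 1 + ∑ i, |x i| := by positivity
  have hL0 (x : Fin n → ℝ) : 0 ≤ L x := mul_nonneg (abs_nonneg K) (hW x)
  have hLc : Continuous L := by fun_prop
  have hb (x : Fin n → ℝ) : ((-L x : ℝ) : EReal) ≤ Φ x := by
    refine le_trans (EReal.coe_le_coe_iff.2 (neg_le_neg ?_)) (hK x)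
    exact mul_le_mul_of_nonneg_right (le_abs_self K) (hW x)
  have hG : LowerSemicontinuous fun x => (Φ x + (L x : EReal)).toENNReal := by
    refine EReal.continuous_toENNReal.comp_lowerSemicontinuous
      (hlsc.add' (continuous_coe_real_ereal.comp hLc).lowerSemicontinuous fun x => ?_)
      fun a b hab => EReal.toENNReal_le_toENNReal hab
    exact EReal.continuousAt_add (.inr (EReal.coe_ne_bot _)) (.inr (EReal.coe_ne_top _))
  have heInt {π : Measure (Fin n → ℝ)} (hπ : MOT.IsMartingaleCoupling π μ) :
      MOT.eInt Φ π = ((∫⁻ x, (Φ x + (L x : EReal)).toENNReal ∂π : ℝ≥0∞) : EReal)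
        - ((|K| * (1 + ∑ i, ∫ s, |s| ∂(μ i)) : ℝ) : EReal) := by
    obtain ⟨hint, hval⟩ := hπ.1.integrable_weight hmom
    rw [MOT.eInt_eq_lintegral_add_sub hlsc.measurable (hint.const_mul |K|) hLc.measurable hL0 hb,
      integral_const_mul, hval]
  obtain ⟨π₀, hπ₀⟩ := hne
  obtain ⟨Q, hQ, hmin⟩ := LowerSemicontinuousOn.exists_isMinOn
    ⟨⟨π₀, hπ₀.1.1⟩, hπ₀⟩ (MOT.isCompact_setOf_isMartingaleCoupling hprob hmom)
    ((lowerSemicontinuous_lintegral hG).lowerSemicontinuousOn _)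
  refine ⟨Q, hQ, le_antisymm (le_sInf ?_) (sInf_le ⟨Q, hQ, rfl⟩)⟩
  rintro _ ⟨π, hπ, rfl⟩
  rw [heInt hQ, heInt hπ]
  refine EReal.sub_le_sub (EReal.coe_ennreal_le_coe_ennreal_iff.2 ?_) le_rfl
  exact hmin (a := ⟨π, hπ.1.1⟩) hπ
end
end

section
/- Let μ₁,…,μₙ be Borel probability measures on ℝ with finite first moments, and let c : ℝⁿ → ℝ be a continuous function such that |c(x₁,…,xₙ)| ≤ K(1+|x₁|+…+|xₙ|) for all (x₁,…,xₙ) ∈ ℝⁿ and some constant K. Then the mapping π ↦ ∫ c dπ is continuous on Π(μ₁,…,μₙ) with respect to the weak topology. -/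
open MeasureTheory
open scoped BigOperators

noncomputable section

open Filter Topology

/-- The tails of an integrable function vanish: `∫ (K |f| - m)⁺ → 0` as `m → ∞`. -/
theorem tendsto_integral_excess_atTop {α : Type*} [MeasurableSpace α] {μ : Measure α}
    {f : α → ℝ} (hf : Integrable f μ) {K : ℝ} (hK : 0 ≤ K) :
    Tendsto (fun m : ℕ => ∫ a, max (K * |f a| - m) 0 ∂μ) atTop (𝓝 0) := by
  have hlim := tendsto_integral_of_dominated_convergence (μ := μ)
    (F := fun (m : ℕ) a => max (K * |f a| - m) 0) (f := fun _ => (0 : ℝ))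
    (fun a => K * |f a|)
    (fun m => (((hf.abs.const_mul K).aestronglyMeasurable.sub
      aestronglyMeasurable_const).sup aestronglyMeasurable_const))
    (hf.abs.const_mul K)
    (fun m => ae_of_all _ fun a => by
      have h : 0 ≤ K * |f a| := mul_nonneg hK (abs_nonneg _)
      have hm : (0 : ℝ) ≤ m := m.cast_nonneg
      rw [Real.norm_eq_abs, abs_of_nonneg (le_max_right _ _)]
      exact max_le (by linarith) h)
    (ae_of_all _ fun a => by
      obtain ⟨N, hN⟩ := exists_nat_ge (K * |f a|)
      refine tendsto_const_nhds.congr' ?_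
      filter_upwards [eventually_ge_atTop N] with m hm
      have : (N : ℝ) ≤ m := by exact_mod_cast hm
      exact (max_eq_right (by linarith)).symm)
  simpa using hlim

/-- The distance from `t` to its truncation to `[-M, M]` is at most any nonnegative `e` with
`|t| ≤ M + e`. -/
theorem abs_sub_truncate_le {t M e : ℝ} (he : 0 ≤ e) (h : |t| ≤ M + e) :
    |t - max (-M) (min M t)| ≤ e := by
  obtain ⟨h₁, h₂⟩ := abs_le.mp h
  rcases max_cases (-M) (min M t) with h₃ | h₃ <;> rcases min_cases M t with h₄ | h₄ <;>
    exact abs_le.mpr ⟨by linarith, by linarith⟩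

/-- Integration of a truncated continuous function is weakly continuous. -/
theorem continuous_integral_truncate {X : Type*} [TopologicalSpace X] [MeasurableSpace X]
    [OpensMeasurableSpace X] {c : X → ℝ} (hc : Continuous c) {M : ℝ} (hM : 0 ≤ M) :
    Continuous (fun π : ProbabilityMeasure X =>
      ∫ x, max (-M) (min M (c x)) ∂(π : Measure X)) := by
  let g : BoundedContinuousFunction X ℝ := BoundedContinuousFunction.ofNormedAddCommGroup
    (fun x => max (-M) (min M (c x))) (by fun_prop) M fun x =>
      abs_le.mpr ⟨le_max_left _ _, max_le (by linarith) (min_le_left _ _)⟩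
  exact continuous_iff_continuousAt.mpr fun π =>
    ProbabilityMeasure.tendsto_iff_forall_integral_tendsto.mp tendsto_id g

/-- **Lemma 2.2.** If `c : ℝⁿ → ℝ` is continuous with `|c(x₁,…,xₙ)| ≤ K (1+|x₁|+…+|xₙ|)`
and `μ₁, …, μₙ` are Borel probability measures on `ℝ` with finite first moments, then
`π ↦ ∫ c dπ` is continuous on `Π(μ₁,…,μₙ)` for the weak topology (the topology of
convergence against bounded continuous functions). -/
theorem integral_continuous_on_couplings {n : ℕ} (μ : Fin n → Measure ℝ)
    (hprob : ∀ i, IsProbabilityMeasure (μ i))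
    (hmom : ∀ i, Integrable (fun s : ℝ => s) (μ i))
    (c : (Fin n → ℝ) → ℝ) (hc : Continuous c)
    (K : ℝ) (hK : ∀ x : Fin n → ℝ, |c x| ≤ K * (1 + ∑ i, |x i|)) :
    Continuous (fun π : {π : ProbabilityMeasure (Fin n → ℝ) //
        ∀ i : Fin n, (π : Measure (Fin n → ℝ)).map (fun x => x i) = μ i} =>
      ∫ x, c x ∂(π : Measure (Fin n → ℝ))) := by
  have hK0 : 0 ≤ K := by simpa using (abs_nonneg _).trans (hK 0)
  refine continuous_of_uniform_approx_of_continuous fun u hu => ?_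
  obtain ⟨ε, hε, hεu⟩ := Metric.mem_uniformity_dist.mp hu
  have htail : Tendsto (fun m : ℕ => ∑ i, ∫ s, max (K * |s| - m) 0 ∂(μ i)) atTop (𝓝 0) := by
    simpa using tendsto_finsetSum Finset.univ
      fun i _ => tendsto_integral_excess_atTop (hmom i) hK0
  obtain ⟨m, hm⟩ := (htail.eventually_lt_const hε).exists
  set M : ℝ := K + n * m
  have hM : 0 ≤ M := by positivity
  refine ⟨_, (continuous_integral_truncate hc hM).comp continuous_subtype_val, ?_⟩
  rintro ⟨π, hπ⟩
  apply hεu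
  have hmap (i : Fin n) {f : ℝ → ℝ} (hf : Integrable f (μ i)) :
      Integrable (fun x => f (x i)) (π : Measure (Fin n → ℝ)) := by
    rw [← hπ i] at hf
    exact hf.comp_measurable (measurable_pi_apply i)
  have hexc (i : Fin n) : Integrable (fun s : ℝ => max (K * |s| - m) 0) (μ i) :=
    (((hmom i).abs.const_mul K).sub (integrable_const _)).sup (integrable_const _)
  have hc_int : Integrable c (π : Measure (Fin n → ℝ)) :=
    Integrable.mono' (((integrable_const 1).add
      (integrable_finsetSum _ fun i _ => hmap i (hmom i).abs)).const_mul K)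
      hc.aestronglyMeasurable (ae_of_all _ fun x => by simpa using hK x)
  have ht_int : Integrable (fun x => max (-M) (min M (c x))) (π : Measure (Fin n → ℝ)) :=
    (integrable_const _).sup ((integrable_const _).inf hc_int)
  have hpt (x : Fin n → ℝ) :
      |c x - max (-M) (min M (c x))| ≤ ∑ i, max (K * |x i| - m) 0 := by
    refine abs_sub_truncate_le (Finset.sum_nonneg fun i _ => le_max_right _ _) ?_
    have hsum : ∑ i, (K * |x i| - m) ≤ ∑ i, max (K * |x i| - m) 0 :=
      Finset.sum_le_sum fun i _ => le_max_left _ _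
    rw [Finset.sum_sub_distrib, ← Finset.mul_sum] at hsum
    simp only [Finset.sum_const, Finset.card_univ, Fintype.card_fin, nsmul_eq_mul] at hsum
    linarith [hK x]
  calc dist (∫ x, c x ∂(π : Measure (Fin n → ℝ)))
        (∫ x, max (-M) (min M (c x)) ∂(π : Measure (Fin n → ℝ)))
      = |∫ x, (c x - max (-M) (min M (c x))) ∂(π : Measure (Fin n → ℝ))| := by
        rw [Real.dist_eq, integral_sub hc_int ht_int]
    _ ≤ ∫ x, |c x - max (-M) (min M (c x))| ∂(π : Measure (Fin n → ℝ)) :=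
        abs_integral_le_integral_abs
    _ ≤ ∫ x, ∑ i, max (K * |x i| - m) 0 ∂(π : Measure (Fin n → ℝ)) :=
        integral_mono (hc_int.sub ht_int).abs
          (integrable_finsetSum _ fun i _ => hmap i (hexc i)) hpt
    _ = ∑ i, ∫ s, max (K * |s| - m) 0 ∂(μ i) := by
        rw [integral_finsetSum _ fun i _ => hmap i (hexc i)]
        refine Finset.sum_congr rfl fun i _ => ?_
        rw [← hπ i, integral_map (measurable_pi_apply i).aemeasurable
          (by fun_prop : Continuous fun s : ℝ => max (K * |s| - m) 0).aestronglyMeasurable]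
    _ < ε := hm
end
end

section
/- Let μ₁,…,μₙ be Borel probability measures on ℝ with finite first moments. Then the set M(μ₁,…,μₙ) of martingale transport plans is compact in the weak topology on probability measures on ℝⁿ. -/
open MeasureTheory
open scoped BigOperators ENNReal

noncomputable section

open Filter Topology BoundedContinuousFunction

section Truncation

/-- Truncation of a real number to the interval `[-N, N]`. -/
def clamp (N : ℕ) (s : ℝ) : ℝ := max (-(N : ℝ)) (min s N)

lemma continuous_clamp (N : ℕ) : Continuous (clamp N) := by
  unfold clamp; fun_prop

lemma abs_clamp_le (N : ℕ) (s : ℝ) : |clamp N s| ≤ N := by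
  have hN : (0 : ℝ) ≤ N := N.cast_nonneg
  exact abs_le.2 ⟨le_max_left _ _, max_le (by linarith) (min_le_right _ _)⟩

lemma clamp_eq_self {N : ℕ} {s : ℝ} (h : |s| ≤ N) : clamp N s = s := by
  rw [abs_le] at h
  rw [clamp, min_eq_left h.2, max_eq_right h.1]

lemma abs_sub_clamp_le (N : ℕ) (s : ℝ) : |s - clamp N s| ≤ |s| := by
  have hN : (0 : ℝ) ≤ N := N.cast_nonneg
  unfold clamp
  rcases le_total s N with h | h
  · rw [min_eq_left h]
    rcases le_total (-(N : ℝ)) s with h' | h'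
    · rw [max_eq_right h']; simp
    · rw [max_eq_left h', abs_of_nonpos (by linarith), abs_of_nonpos (by linarith)]
      linarith
  · rw [min_eq_right h, max_eq_right (by linarith), abs_of_nonneg (by linarith),
      abs_of_nonneg (by linarith)]
    linarith

lemma integrable_sub_clamp {ν : Measure ℝ} (hν : Integrable (fun s : ℝ => s) ν) (N : ℕ) :
    Integrable (fun s => |s - clamp N s|) ν :=
  hν.mono (by have := continuous_clamp N; fun_prop)
    (ae_of_all _ fun s => by simpa using abs_sub_clamp_le N s)

lemma tendsto_integral_sub_clamp {ν : Measure ℝ} (hν : Integrable (fun s : ℝ => s) ν) :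
    Tendsto (fun N : ℕ => ∫ s, |s - clamp N s| ∂ν) atTop (𝓝 0) := by
  rw [← integral_zero ℝ ℝ (μ := ν)]
  refine tendsto_integral_of_dominated_convergence (fun s => |s|)
    (fun N => (integrable_sub_clamp hν N).aestronglyMeasurable) hν.abs
    (fun N => ae_of_all _ fun s => by simpa using abs_sub_clamp_le N s)
    (ae_of_all _ fun s => tendsto_const_nhds.congr' ?_)
  filter_upwards [eventually_ge_atTop ⌈|s|⌉₊] with N hN
  rw [clamp_eq_self (Nat.ceil_le.1 hN)]
  simp

end Truncation

lemma integrable_of_map_eq {X : Type*} [MeasurableSpace X] {π : Measure X} {f : X → ℝ} (hf : Measurable f) {ν : Measure ℝ}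
    (h : π.map f = ν) {φ : ℝ → ℝ} (hφ : Integrable φ ν) : Integrable (fun x => φ (f x)) π := by
  subst h
  exact (integrable_map_measure hφ.aestronglyMeasurable hf.aemeasurable).1 hφ

/-- Integrating a bounded continuous function times a continuous `f` is weakly continuous on the
set of probability measures under which `f` has a prescribed integrable law. -/
lemma continuousOn_integral_mul_of_map_eq {X : Type*} [TopologicalSpace X] [MeasurableSpace X]
    [BorelSpace X] {f : X → ℝ} (hf : Continuous f) {ν : Measure ℝ}
    (hν : Integrable (fun s : ℝ => s) ν) (g : X →ᵇ ℝ) :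
    ContinuousOn (fun π : ProbabilityMeasure X => ∫ x, g x * f x ∂(π : Measure X))
      {π : ProbabilityMeasure X | (π : Measure X).map f = ν} := by
  let G (N : ℕ) : X →ᵇ ℝ := g * BoundedContinuousFunction.ofNormedAddCommGroup
    (fun x => clamp N (f x)) ((continuous_clamp N).comp hf) N fun x => abs_clamp_le N (f x)
  have hG (N : ℕ) (x : X) : G N x = g x * clamp N (f x) := rfl
  have hunif : TendstoUniformlyOn
      (fun (N : ℕ) (π : ProbabilityMeasure X) => ∫ x, G N x ∂(π : Measure X))
      (fun π => ∫ x, g x * f x ∂(π : Measure X)) atTop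
      {π : ProbabilityMeasure X | (π : Measure X).map f = ν} := by
    rw [Metric.tendstoUniformlyOn_iff]
    intro ε hε
    have hlim := (tendsto_integral_sub_clamp hν).const_mul ‖g‖
    rw [mul_zero] at hlim
    filter_upwards [hlim.eventually_lt_const hε] with N hN π hπ
    refine lt_of_le_of_lt ?_ hN
    have hfi : Integrable f (π : Measure X) := integrable_of_map_eq hf.measurable hπ hν
    have hgf : Integrable (fun x => g x * f x) (π : Measure X) :=
      hfi.bdd_mul g.continuous.aestronglyMeasurable (ae_of_all _ g.norm_coe_le_norm)
    rw [Real.dist_eq, ← integral_sub hgf ((G N).integrable _), ← Real.norm_eq_abs]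
    calc ‖∫ x, (g x * f x - G N x) ∂(π : Measure X)‖
        ≤ ∫ x, ‖g‖ * |f x - clamp N (f x)| ∂(π : Measure X) := by
          refine norm_integral_le_of_norm_le
            ((integrable_of_map_eq hf.measurable hπ (integrable_sub_clamp hν N)).const_mul _)
            (ae_of_all _ fun x => ?_)
          rw [hG, ← mul_sub, norm_mul, Real.norm_eq_abs (f x - _)]
          gcongr
          exact g.norm_coe_le_norm x
      _ = ‖g‖ * ∫ s, |s - clamp N s| ∂ν := by
          rw [integral_const_mul, ← (show (π : Measure X).map f = ν from hπ), integral_map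
            hf.measurable.aemeasurable
            (by have := continuous_clamp N; fun_prop)]
  exact hunif.continuousOn (Frequently.of_forall fun N =>
    (ProbabilityMeasure.continuous_integral_boundedContinuousFunction (G N)).continuousOn)

/-- An integrable function orthogonal to all bounded continuous functions of `r` is orthogonal to
all bounded measurable functions of `r`. -/
lemma integral_comp_mul_eq_zero_of_forall_continuous {X Y : Type*} [MeasurableSpace X]
    [TopologicalSpace Y] [HasOuterApproxClosed Y] [MeasurableSpace Y] [BorelSpace Y]
    {π : Measure X} {f : X → ℝ} (hf : Integrable f π) (hfm : Measurable f)
    {r : X → Y} (hr : Measurable r)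
    (h : ∀ g : Y →ᵇ ℝ, ∫ x, g (r x) * f x ∂π = 0)
    {G : Y → ℝ} (hG : Measurable G) {C : ℝ} (hC : ∀ y, |G y| ≤ C) :
    ∫ x, G (r x) * f x ∂π = 0 := by
  let ν (u : X → ℝ) : Measure Y := (π.withDensity fun x => ENNReal.ofReal (u x)).map r
  have hν {u : X → ℝ} (hu : Measurable u) {H : Y → ℝ} (hH : Measurable H) :
      ∫ y, H y ∂(ν u) = ∫ x, H (r x) * max (u x) 0 ∂π := by
    rw [integral_map hr.aemeasurable hH.aestronglyMeasurable,
      integral_withDensity_eq_integral_toReal_smul hu.ennreal_ofReal (by simp)]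
    simp [ENNReal.toReal_ofReal', mul_comm]
  have hsplit {H : Y → ℝ} (hH : Measurable H) {C : ℝ} (hC : ∀ y, |H y| ≤ C) :
      ∫ x, H (r x) * f x ∂π = ∫ y, H y ∂(ν f) - ∫ y, H y ∂(ν (-f)) := by
    have hbdd {u : X → ℝ} (hu : Integrable u π) : Integrable (fun x => H (r x) * u x) π :=
      hu.bdd_mul (hH.comp hr).aestronglyMeasurable (ae_of_all _ fun x => hC (r x))
    rw [hν hfm hH, hν hfm.neg hH]
    simp only [Pi.neg_apply]
    rw [← integral_sub (hbdd hf.pos_part) (hbdd hf.neg_part)]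
    simp_rw [← mul_sub, max_zero_sub_max_neg_zero_eq_self]
  have : IsFiniteMeasure (π.withDensity fun x => ENNReal.ofReal (f x)) :=
    isFiniteMeasure_withDensity_ofReal hf.2
  have : IsFiniteMeasure (π.withDensity fun x => ENNReal.ofReal ((-f) x)) :=
    isFiniteMeasure_withDensity_ofReal hf.neg.2
  have heq : ν f = ν (-f) := ext_of_forall_integral_eq_of_IsFiniteMeasure fun g => by
    have := hsplit g.continuous.measurable g.norm_coe_le_norm
    rw [h g] at this
    linarith
  rw [hsplit hG hC, heq, sub_self]

namespace MOT

lemma coord_eq {n j : ℕ} (h : j < n) (x : Fin n → ℝ) : coord x j = x ⟨j, h⟩ := dif_pos h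

lemma isTightMeasureSet_isCoupling {n : ℕ} (μ : Fin n → Measure ℝ)
    (hprob : ∀ i, IsProbabilityMeasure (μ i)) :
    IsTightMeasureSet {π : Measure (Fin n → ℝ) | IsCoupling π μ} := by
  rw [isTightMeasureSet_iff_exists_isCompact_measure_compl_le]
  intro ε hε
  obtain ⟨δ, hδ, hsum⟩ := ENNReal.exists_pos_sum_of_countable hε.ne' (Fin n)
  have hK (i : Fin n) : ∃ K : Set ℝ, IsCompact K ∧ μ i Kᶜ ≤ δ i := by
    obtain ⟨K, hK, hμK⟩ := isTightMeasureSet_iff_exists_isCompact_measure_compl_le.1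
      (isTightMeasureSet_singleton (μ := μ i)) (δ i) (by simpa using hδ i)
    exact ⟨K, hK, hμK _ rfl⟩
  choose K hKc hKμ using hK
  refine ⟨Set.univ.pi K, isCompact_univ_pi hKc, fun π hπ => ?_⟩
  have hsub : (Set.univ.pi K)ᶜ ⊆ ⋃ i, (fun x : Fin n → ℝ => x i) ⁻¹' (K i)ᶜ := by
    intro x hx
    simpa [Set.mem_pi] using hx
  calc π (Set.univ.pi K)ᶜ
      ≤ ∑' i, π ((fun x : Fin n → ℝ => x i) ⁻¹' (K i)ᶜ) :=
        (measure_mono hsub).trans (measure_iUnion_le _)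
    _ ≤ ∑' i, (δ i : ℝ≥0∞) := by
        refine ENNReal.tsum_le_tsum fun i => ?_
        rw [← Measure.map_apply (measurable_pi_apply i) (hKc i).measurableSet.compl, hπ.2 i]
        exact hKμ i
    _ ≤ ε := hsum.le

lemma isClosed_isCoupling {n : ℕ} (μ : Fin n → Measure ℝ)
    (hprob : ∀ i, IsProbabilityMeasure (μ i)) :
    IsClosed {π : ProbabilityMeasure (Fin n → ℝ) | IsCoupling (π : Measure (Fin n → ℝ)) μ} := by
  have hset : {π : ProbabilityMeasure (Fin n → ℝ) | IsCoupling (π : Measure (Fin n → ℝ)) μ} =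
      ⋂ i, (fun π : ProbabilityMeasure (Fin n → ℝ) =>
        π.map (continuous_apply i).measurable.aemeasurable) ⁻¹' {⟨μ i, hprob i⟩} := by
    ext π
    simp only [Set.mem_iInter, Set.mem_preimage]
    exact ⟨fun h i => Subtype.ext (h.2 i),
      fun h => ⟨π.2, fun i => congrArg Subtype.val (Set.mem_singleton_iff.1 (h i))⟩⟩
  rw [hset]
  exact isClosed_iInter fun i =>
    isClosed_singleton.preimage (ProbabilityMeasure.continuous_map (continuous_apply i))

/-- The projection that keeps the coordinates up to index `j` and sets the others to `0`. -/
def keepUpTo {n : ℕ} (j : ℕ) (x : Fin n → ℝ) (i : Fin n) : ℝ := if (i : ℕ) ≤ j then x i else 0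

lemma continuous_keepUpTo {n : ℕ} (j : ℕ) : Continuous (keepUpTo (n := n) j) := by
  refine continuous_pi fun i => ?_
  by_cases h : (i : ℕ) ≤ j
  · simpa [keepUpTo, h] using continuous_apply i
  · simpa [keepUpTo, h] using continuous_const

lemma coord_keepUpTo {n i j : ℕ} (h : i ≤ j) (x : Fin n → ℝ) :
    coord (keepUpTo j x) i = coord x i := by
  simp [coord, keepUpTo, h]

lemma keepUpTo_congr {n j : ℕ} {x y : Fin n → ℝ} (h : ∀ i, i ≤ j → coord x i = coord y i) :
    keepUpTo j x = keepUpTo j y := by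
  funext i
  unfold keepUpTo
  split_ifs with hi
  · simpa [coord] using h i hi
  · rfl

/-- For couplings with integrable marginals it suffices to test the martingale property against
bounded continuous functions. -/
lemma isMartingaleCoupling_iff_forall_continuous {n : ℕ} {μ : Fin n → Measure ℝ}
    (hmom : ∀ i, Integrable (fun s : ℝ => s) (μ i)) {π : Measure (Fin n → ℝ)}
    (hπ : IsCoupling π μ) :
    IsMartingaleCoupling π μ ↔ ∀ (j : ℕ) (hj : j + 1 < n) (g : (Fin n → ℝ) →ᵇ ℝ),
      ∫ x, g (keepUpTo j x) * (x ⟨j + 1, hj⟩ - x ⟨j, by omega⟩) ∂π = 0 := by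
  constructor
  · intro h j hj g
    have := h.2 j hj (fun x => g (keepUpTo j x))
      (g.continuous.comp (continuous_keepUpTo j)).measurable
      ⟨‖g‖, fun x => g.norm_coe_le_norm _⟩
      (fun x y hxy => by rw [keepUpTo_congr hxy])
    simpa only [coord_eq hj, coord_eq (show j < n by omega)] using this
  · refine fun h => ⟨hπ, fun j hj Δ hΔ ⟨C, hC⟩ hdep => ?_⟩
    have hint (i : Fin n) : Integrable (fun x : Fin n → ℝ => x i) π :=
      integrable_of_map_eq (measurable_pi_apply i) (hπ.2 i) (hmom i)
    have hΔr (x : Fin n → ℝ) : Δ x = Δ (keepUpTo j x) :=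
      hdep _ _ fun i hi => (coord_keepUpTo hi x).symm
    simp only [coord_eq hj, coord_eq (show j < n by omega)]
    refine (integral_congr_ae (ae_of_all _ fun x => congrArg (· * _) (hΔr x))).trans ?_
    exact integral_comp_mul_eq_zero_of_forall_continuous ((hint _).sub (hint _))
      (by fun_prop) (continuous_keepUpTo j).measurable (h j hj) hΔ hC

lemma isClosed_isMartingaleCoupling {n : ℕ} (μ : Fin n → Measure ℝ)
    (hprob : ∀ i, IsProbabilityMeasure (μ i))
    (hmom : ∀ i, Integrable (fun s : ℝ => s) (μ i)) :
    IsClosed {π : ProbabilityMeasure (Fin n → ℝ) |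
      IsMartingaleCoupling (π : Measure (Fin n → ℝ)) μ} := by
  let S := {π : ProbabilityMeasure (Fin n → ℝ) | IsCoupling (π : Measure (Fin n → ℝ)) μ}
  have hS : IsClosed S := isClosed_isCoupling μ hprob
  have hset : {π : ProbabilityMeasure (Fin n → ℝ) |
      IsMartingaleCoupling (π : Measure (Fin n → ℝ)) μ} =
      S ∩ ⋂ (j : ℕ) (hj : j + 1 < n) (g : (Fin n → ℝ) →ᵇ ℝ),
        S ∩ (fun π : ProbabilityMeasure (Fin n → ℝ) => ∫ x, g (keepUpTo j x) *
          (x ⟨j + 1, hj⟩ - x ⟨j, by omega⟩) ∂(π : Measure (Fin n → ℝ))) ⁻¹' {0} := by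
    ext π
    simp only [Set.mem_inter_iff, Set.mem_iInter, Set.mem_preimage, Set.mem_singleton_iff,
      Set.mem_ofPred_eq]
    exact ⟨fun h => ⟨h.1, fun j hj g =>
        ⟨h.1, (isMartingaleCoupling_iff_forall_continuous hmom h.1).1 h j hj g⟩⟩,
      fun h => (isMartingaleCoupling_iff_forall_continuous hmom h.1).2
        fun j hj g => (h.2 j hj g).2⟩
  rw [hset]
  refine hS.inter (isClosed_iInter fun j => isClosed_iInter fun hj => isClosed_iInter fun g => ?_)
  refine ContinuousOn.preimage_isClosed_of_isClosed ?_ hS isClosed_singleton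
  let g' : (Fin n → ℝ) →ᵇ ℝ := g.compContinuous ⟨keepUpTo j, continuous_keepUpTo j⟩
  have hcont (i : Fin n) : ContinuousOn (fun π : ProbabilityMeasure (Fin n → ℝ) =>
      ∫ x, g' x * x i ∂(π : Measure (Fin n → ℝ))) S :=
    (continuousOn_integral_mul_of_map_eq (continuous_apply i) (hmom i) g').mono
      fun π hπ => hπ.2 i
  refine ((hcont ⟨j + 1, hj⟩).sub (hcont ⟨j, by omega⟩)).congr fun π hπ => ?_
  have hint (i : Fin n) : Integrable (fun x => g' x * x i) (π : Measure (Fin n → ℝ)) :=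
    (integrable_of_map_eq (measurable_pi_apply i) (hπ.2 i) (hmom i)).bdd_mul
      g'.continuous.aestronglyMeasurable (ae_of_all _ g'.norm_coe_le_norm)
  rw [Pi.sub_apply, ← integral_sub (hint _) (hint _)]
  simp only [← mul_sub]
  rfl

end MOT

/-- **Proposition 2.4.** For Borel probability measures `μ₁, …, μₙ` on `ℝ` with finite
first moments, the set `M(μ₁, …, μₙ)` of martingale transport plans is compact in the weak
topology on probability measures on `ℝⁿ`. -/
theorem martingale_couplings_compact {n : ℕ} (μ : Fin n → Measure ℝ)
    (hprob : ∀ i, IsProbabilityMeasure (μ i))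
    (hmom : ∀ i, Integrable (fun s : ℝ => s) (μ i)) :
    IsCompact {π : ProbabilityMeasure (Fin n → ℝ) |
      MOT.IsMartingaleCoupling (π : Measure (Fin n → ℝ)) μ} := by
  rw [← (MOT.isClosed_isMartingaleCoupling μ hprob hmom).closure_eq]
  refine isCompact_closure_of_isTightMeasureSet
    ((MOT.isTightMeasureSet_isCoupling μ hprob).subset ?_)
  rintro _ ⟨π, hπ, rfl⟩
  exact hπ.1
end
end

section
/- Assume μ₁, μ₂ are probability measures on ℝ having finite first moments, let Q ∈ M(μ₁, μ₂), and fix s ∈ ℝ. Then the following are equivalent: (i) ∫ (s₁ − s)⁺ dμ₁(s₁) = ∫ (s₂ − s)⁺ dμ₂(s₂); (ii) Q-almost surely, S₁ ≤ s implies S₂ ≤ s, and S₁ > s implies S₂ ≥ s, where (S₁, S₂) are the coordinate projections on ℝ². In particular, if (ii) holds for one measure in M(μ₁, μ₂), then it holds for every element of M(μ₁, μ₂). -/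
open MeasureTheory
open scoped BigOperators ENNReal

noncomputable section

namespace MOT2

/-- `Q ∈ M(μ₁, μ₂)`: `Q` is a Borel probability measure on `ℝ²` with marginals `μ₁, μ₂`
under which the coordinate process `(S₁, S₂)` is a martingale, i.e.
`∫ Δ(s₁)(s₂ - s₁) dQ = 0` for every bounded measurable `Δ : ℝ → ℝ`. -/
def IsMartingaleCoupling (Q : Measure (ℝ × ℝ)) (μ₁ μ₂ : Measure ℝ) : Prop :=
  IsProbabilityMeasure Q ∧ Q.map Prod.fst = μ₁ ∧ Q.map Prod.snd = μ₂ ∧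
    ∀ Δ : ℝ → ℝ, Measurable Δ → (∃ C, ∀ x, |Δ x| ≤ C) →
      ∫ p : ℝ × ℝ, Δ p.1 * (p.2 - p.1) ∂Q = 0

end MOT2

namespace MOT2

/-- The gap in the tangent-line inequality for the call payoff `x ↦ (x - s)⁺` at `p.1`,
evaluated at `p.2`. -/
def callGap (s : ℝ) (p : ℝ × ℝ) : ℝ :=
  max (p.2 - s) 0 - max (p.1 - s) 0 - (Set.Ioi s).indicator 1 p.1 * (p.2 - p.1)

lemma callGap_nonneg (s : ℝ) (p : ℝ × ℝ) : 0 ≤ callGap s p := by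
  unfold callGap
  by_cases h : s < p.1
  · rw [Set.indicator_of_mem (Set.mem_Ioi.2 h), max_eq_left (by linarith : 0 ≤ p.1 - s),
      Pi.one_apply]
    linarith [le_max_left (p.2 - s) 0]
  · rw [Set.indicator_of_notMem (by simpa using h), max_eq_right (by linarith : p.1 - s ≤ 0)]
    linarith [le_max_right (p.2 - s) 0]

lemma callGap_eq_zero_iff (s : ℝ) (p : ℝ × ℝ) :
    callGap s p = 0 ↔ (p.1 ≤ s → p.2 ≤ s) ∧ (s < p.1 → s ≤ p.2) := by
  unfold callGap
  by_cases h : s < p.1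
  · rw [Set.indicator_of_mem (Set.mem_Ioi.2 h), max_eq_left (by linarith : 0 ≤ p.1 - s),
      Pi.one_apply]
    refine ⟨fun h0 => ⟨fun h' => absurd h' h.not_ge, fun _ => ?_⟩, fun h0 => ?_⟩
    · linarith [le_max_right (p.2 - s) 0]
    · rw [max_eq_left (by linarith [h0.2 h])]
      ring
  · rw [Set.indicator_of_notMem (by simpa using h), max_eq_right (by linarith : p.1 - s ≤ 0)]
    refine ⟨fun h0 => ⟨fun _ => ?_, fun h' => absurd h' h⟩, fun h0 => ?_⟩
    · linarith [le_max_left (p.2 - s) 0]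
    · rw [max_eq_right (by linarith [h0.1 (not_lt.1 h)])]
      ring

lemma IsMartingaleCoupling.integrable_callGap_and_integral_eq {Q : Measure (ℝ × ℝ)}
    {μ₁ μ₂ : Measure ℝ} (hQ : IsMartingaleCoupling Q μ₁ μ₂)
    (hmom₁ : Integrable (fun x : ℝ => x) μ₁) (hmom₂ : Integrable (fun x : ℝ => x) μ₂) (s : ℝ) :
    Integrable (callGap s) Q ∧
      ∫ p, callGap s p ∂Q = ∫ x, max (x - s) 0 ∂μ₂ - ∫ x, max (x - s) 0 ∂μ₁ := by
  obtain ⟨hprob, rfl, rfl, hmart⟩ := hQ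
  have hfst : Integrable (fun p : ℝ × ℝ => p.1) Q := hmom₁.comp_measurable measurable_fst
  have hsnd : Integrable (fun p : ℝ × ℝ => p.2) Q := hmom₂.comp_measurable measurable_snd
  have hcall₁ : Integrable (fun p : ℝ × ℝ => max (p.1 - s) 0) Q :=
    (hfst.sub (integrable_const s)).pos_part
  have hcall₂ : Integrable (fun p : ℝ × ℝ => max (p.2 - s) 0) Q :=
    (hsnd.sub (integrable_const s)).pos_part
  have hΔ : Measurable ((Set.Ioi s).indicator (1 : ℝ → ℝ)) :=
    measurable_one.indicator measurableSet_Ioi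
  have hbound (x : ℝ) : |(Set.Ioi s).indicator (1 : ℝ → ℝ) x| ≤ 1 := by
    by_cases h : x ∈ Set.Ioi s <;> simp [h]
  have hgain : Integrable
      (fun p : ℝ × ℝ => (Set.Ioi s).indicator (1 : ℝ → ℝ) p.1 * (p.2 - p.1)) Q :=
    (hsnd.sub hfst).bdd_mul (hΔ.comp measurable_fst).aestronglyMeasurable
      (.of_forall fun p => hbound p.1)
  have hpayoff : Measurable fun x : ℝ => max (x - s) 0 := by fun_prop
  have hspread : Integrable (fun p : ℝ × ℝ => max (p.2 - s) 0 - max (p.1 - s) 0) Q :=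
    hcall₂.sub hcall₁
  refine ⟨hspread.sub hgain, ?_⟩
  unfold callGap
  rw [integral_sub hspread hgain, integral_sub hcall₂ hcall₁,
    hmart _ hΔ ⟨1, hbound⟩, sub_zero,
    integral_map measurable_fst.aemeasurable hpayoff.aestronglyMeasurable,
    integral_map measurable_snd.aemeasurable hpayoff.aestronglyMeasurable]

lemma IsMartingaleCoupling.integral_call_eq_iff {Q : Measure (ℝ × ℝ)} {μ₁ μ₂ : Measure ℝ}
    (hQ : IsMartingaleCoupling Q μ₁ μ₂)
    (hmom₁ : Integrable (fun x : ℝ => x) μ₁) (hmom₂ : Integrable (fun x : ℝ => x) μ₂) (s : ℝ) :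
    (∫ x, max (x - s) 0 ∂μ₁ = ∫ x, max (x - s) 0 ∂μ₂) ↔
      ∀ᵐ p : ℝ × ℝ ∂Q, (p.1 ≤ s → p.2 ≤ s) ∧ (s < p.1 → s ≤ p.2) := by
  obtain ⟨hint, heq⟩ := hQ.integrable_callGap_and_integral_eq hmom₁ hmom₂ s
  have hzero := integral_eq_zero_iff_of_nonneg (callGap_nonneg s) hint
  rw [heq, sub_eq_zero, eq_comm] at hzero
  rw [hzero]
  exact Filter.eventually_congr (.of_forall fun p => callGap_eq_zero_iff s p)

end MOT2

/-- **Lemma 4.2.** Let `μ₁, μ₂` be probability measures on `ℝ` with finite first moments,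
let `Q ∈ M(μ₁, μ₂)` and fix `s ∈ ℝ`. Then the call prices `∫ (s₁ - s)⁺ dμ₁` and
`∫ (s₂ - s)⁺ dμ₂` are equal if and only if `Q`-a.s. `S₁ ≤ s ⇒ S₂ ≤ s` and
`S₁ > s ⇒ S₂ ≥ s`. In particular, if the latter holds for one element of `M(μ₁, μ₂)` then
it holds for every element of `M(μ₁, μ₂)`. -/
theorem equal_call_prices_iff {μ₁ μ₂ : Measure ℝ}
    (hprob₁ : IsProbabilityMeasure μ₁) (hprob₂ : IsProbabilityMeasure μ₂)
    (hmom₁ : Integrable (fun x : ℝ => x) μ₁) (hmom₂ : Integrable (fun x : ℝ => x) μ₂)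
    (Q : Measure (ℝ × ℝ)) (hQ : MOT2.IsMartingaleCoupling Q μ₁ μ₂) (s : ℝ) :
    ((∫ x, max (x - s) 0 ∂μ₁ = ∫ x, max (x - s) 0 ∂μ₂) ↔
      (∀ᵐ p : ℝ × ℝ ∂Q, (p.1 ≤ s → p.2 ≤ s) ∧ (s < p.1 → s ≤ p.2))) ∧
    ((∃ Q' : Measure (ℝ × ℝ), MOT2.IsMartingaleCoupling Q' μ₁ μ₂ ∧
        (∀ᵐ p : ℝ × ℝ ∂Q', (p.1 ≤ s → p.2 ≤ s) ∧ (s < p.1 → s ≤ p.2))) →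
      ∀ Q'' : Measure (ℝ × ℝ), MOT2.IsMartingaleCoupling Q'' μ₁ μ₂ →
        (∀ᵐ p : ℝ × ℝ ∂Q'', (p.1 ≤ s → p.2 ≤ s) ∧ (s < p.1 → s ≤ p.2))) := by
  refine ⟨hQ.integral_call_eq_iff hmom₁ hmom₂ s, ?_⟩
  rintro ⟨Q', hQ', hae⟩ Q'' hQ''
  exact (hQ''.integral_call_eq_iff hmom₁ hmom₂ s).1
    ((hQ'.integral_call_eq_iff hmom₁ hmom₂ s).2 hae)
end
end

section
/- Let Φ : ℝ² → (−∞,∞] be a lower semi-continuous function with Φ(s₁,s₂) ≥ −K(1+|s₁|+|s₂|) for all s₁, s₂ ∈ ℝ and some constant K, let μ₁, μ₂ be Borel probability measures on ℝ with finite first moments, and assume there exists Q ∈ M(μ₁, μ₂) with ∫ Φ dQ < ∞. Then P = sup over μ₂-integrable functions u₂ : ℝ → ℝ of [ ∫ (Φ(s₁, ·) − u₂)**(s₁) dμ₁(s₁) + ∫ u₂ dμ₂ ], where P = inf{∫ Φ dQ : Q ∈ M(μ₁, μ₂)} and for each fixed s₁, (Φ(s₁, ·) − u₂)** denotes the convex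 envelope in the second variable evaluated at s₁. -/
open MeasureTheory
open scoped BigOperators ENNReal

noncomputable section

namespace MOT2

/-- The positive part of an extended real, as an element of `ℝ≥0∞`. -/
def toENN (a : EReal) : ℝ≥0∞ := if a = ⊤ then ⊤ else ENNReal.ofReal a.toReal

/-- Extended integral of an `EReal`-valued function: positive part minus negative part. -/
def eInt {α : Type*} [MeasurableSpace α] (Φ : α → EReal) (π : Measure α) : EReal :=
  ((∫⁻ x, toENN (Φ x) ∂π : ℝ≥0∞) : EReal) - ((∫⁻ x, toENN (-(Φ x)) ∂π : ℝ≥0∞) : EReal)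

/-- Convexity for `EReal`-valued functions on `ℝ`. -/
def EConvexOn (h : ℝ → EReal) : Prop :=
  ∀ x y : ℝ, ∀ t : ℝ, 0 ≤ t → t ≤ 1 →
    h (t * x + (1 - t) * y) ≤ (t : EReal) * h x + ((1 - t : ℝ) : EReal) * h y

/-- The convex envelope `g**` of `g : ℝ → EReal`: the pointwise supremum of all convex
functions lying below `g`, i.e. the largest convex function `≤ g`. -/
def convexEnvelope (g : ℝ → EReal) (x : ℝ) : EReal :=
  ⨆ h : {h : ℝ → EReal // EConvexOn h ∧ ∀ y, h y ≤ g y}, (h : ℝ → EReal) x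

end MOT2

namespace MOT2

open Filter Topology

lemma toENN_coe (r : ℝ) : toENN (r : EReal) = ENNReal.ofReal r := by
  simp [toENN]

lemma toENN_mono {a b : EReal} (h : a ≤ b) : toENN a ≤ toENN b :=
  EReal.toENNReal_le_toENNReal h

lemma eInt_mono_ae {α : Type*} [MeasurableSpace α] {f g : α → EReal} {μ : Measure α}
    (h : ∀ᵐ x ∂μ, f x ≤ g x) : eInt f μ ≤ eInt g μ := by
  refine EReal.sub_le_sub ?_ ?_
  · exact EReal.coe_ennreal_le_coe_ennreal_iff.2
      (lintegral_mono_ae (h.mono fun x hx => toENN_mono hx))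
  · exact EReal.coe_ennreal_le_coe_ennreal_iff.2
      (lintegral_mono_ae (h.mono fun x hx => toENN_mono (EReal.neg_le_neg_iff.2 hx)))

lemma eInt_congr_ae {α : Type*} [MeasurableSpace α] {f g : α → EReal} {μ : Measure α}
    (h : ∀ᵐ x ∂μ, f x = g x) : eInt f μ = eInt g μ :=
  le_antisymm (eInt_mono_ae (h.mono fun _ hx => hx.le))
    (eInt_mono_ae (h.mono fun _ hx => hx.ge))

lemma eInt_coe {α : Type*} [MeasurableSpace α] {f : α → ℝ} {μ : Measure α}
    (hf : Integrable f μ) : eInt (fun x => (f x : EReal)) μ = ((∫ x, f x ∂μ : ℝ) : EReal) := by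
  have hA : ∫⁻ x, ENNReal.ofReal (f x) ∂μ ≠ ⊤ := hf.lintegral_lt_top.ne
  have hB : ∫⁻ x, ENNReal.ofReal (-f x) ∂μ ≠ ⊤ := hf.neg.lintegral_lt_top.ne
  simp only [eInt, ← EReal.coe_neg, toENN_coe]
  rw [integral_eq_lintegral_pos_part_sub_lintegral_neg_part hf, EReal.coe_sub,
    EReal.coe_ennreal_toReal hA, EReal.coe_ennreal_toReal hB]

/-- A function with values in `(-∞, ∞]`, bounded below by an integrable function and with finite
extended integral, is almost everywhere equal to an integrable real function. -/
lemma integrable_toReal_of_eInt_lt_top {α : Type*} [MeasurableSpace α] {f : α → EReal}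
    {μ : Measure α} (hf : Measurable f) {b : α → ℝ} (hb : Integrable b μ)
    (hbf : ∀ x, (b x : EReal) ≤ f x) (hfin : eInt f μ < ⊤) :
    Integrable (fun x => (f x).toReal) μ ∧ ∀ᵐ x ∂μ, f x = ((f x).toReal : EReal) := by
  have hneg : ∫⁻ x, toENN (-(f x)) ∂μ ≠ ⊤ := by
    refine ne_top_of_le_ne_top hb.neg.lintegral_lt_top.ne (lintegral_mono fun x => ?_)
    rw [← toENN_coe]
    exact toENN_mono (by simpa using EReal.neg_le_neg_iff.2 (hbf x))
  have hpos : ∫⁻ x, toENN (f x) ∂μ ≠ ⊤ := by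
    intro h
    rw [eInt, h] at hfin
    lift ∫⁻ x, toENN (-(f x)) ∂μ to NNReal using hneg with B
    exact hfin.ne (by simp)
  have hm : Measurable fun x => toENN (f x) := hf.ereal_toENNReal
  have htop : ∀ᵐ x ∂μ, f x = ((f x).toReal : EReal) := by
    filter_upwards [ae_lt_top hm hpos] with x hx
    refine (EReal.coe_toReal ?_ ?_).symm
    · rintro h
      simp [toENN, h] at hx
    · exact (lt_of_lt_of_le (EReal.bot_lt_coe _) (hbf x)).ne'
  refine ⟨⟨hf.ereal_toReal.aestronglyMeasurable, ?_⟩, htop⟩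
  rw [hasFiniteIntegral_iff_norm]
  calc ∫⁻ x, ENNReal.ofReal ‖(f x).toReal‖ ∂μ
      ≤ ∫⁻ x, (toENN (f x) + toENN (-(f x))) ∂μ := by
        refine lintegral_mono_ae ?_
        filter_upwards [htop] with x hx
        rw [hx, ← EReal.coe_neg, toENN_coe, toENN_coe, EReal.toReal_coe, Real.norm_eq_abs]
        rcases abs_cases (f x).toReal with h | h <;> rw [h.1] <;> simp
    _ < ⊤ := by
        rw [lintegral_add_left hm]
        exact ENNReal.add_lt_top.2 ⟨hpos.lt_top, hneg.lt_top⟩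

lemma EConvexOn.eq_bot_of_eq_bot {h : ℝ → EReal} (hc : EConvexOn h) {x : ℝ} (hx : h x = ⊥)
    (y : ℝ) : h y = ⊥ := by
  have := hc x (2 * y - x) (1 / 2) (by norm_num) (by norm_num)
  rw [hx, EReal.coe_mul_bot_of_pos (by norm_num), EReal.bot_add, le_bot_iff] at this
  rwa [show 1 / 2 * x + (1 - 1 / 2) * (2 * y - x) = y by ring] at this

lemma ae_eq_mean_of_le_or_ge {κ : Measure ℝ} [IsProbabilityMeasure κ] {x : ℝ}
    (hInt : Integrable (fun y => y) κ) (hmean : ∫ y, y ∂κ = x)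
    (h : (∀ᵐ y ∂κ, y ≤ x) ∨ ∀ᵐ y ∂κ, x ≤ y) : ∀ᵐ y ∂κ, y = x := by
  have hzero : ∫ y, (x - y) ∂κ = 0 := by
    rw [integral_sub (integrable_const _) hInt, hmean]; simp
  have hi : Integrable (fun y => x - y) κ := (integrable_const _).sub hInt
  rcases h with h | h
  · have := (integral_eq_zero_iff_of_nonneg_ae (f := fun y => x - y)
      (h.mono fun y hy => by simpa using hy) hi).1 hzero
    filter_upwards [this] with y hy
    simp only [Pi.zero_apply] at hy
    linarith
  · have := (integral_eq_zero_iff_of_nonneg_ae (f := fun y => -(x - y))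
      (h.mono fun y hy => by simpa using hy) hi.neg).1 (by rw [integral_neg, hzero, neg_zero])
    filter_upwards [this] with y hy
    simp only [Pi.zero_apply] at hy
    linarith

/-- Jensen's inequality for convex minorants with extended real values. -/
lemma EConvexOn.le_integral {h : ℝ → EReal} (hc : EConvexOn h) {κ : Measure ℝ}
    [IsProbabilityMeasure κ] {x : ℝ} (hInt : Integrable (fun y => y) κ)
    (hmean : ∫ y, y ∂κ = x) {g : ℝ → ℝ} (hg : Integrable g κ)
    (hhg : ∀ᵐ y ∂κ, h y ≤ (g y : EReal)) : h x ≤ ((∫ y, g y ∂κ : ℝ) : EReal) := by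
  by_cases hbot : ∃ z, h z = ⊥
  · obtain ⟨z, hz⟩ := hbot
    rw [hc.eq_bot_of_eq_bot hz x]; exact bot_le
  push Not at hbot
  have hdirac : (∀ᵐ y ∂κ, y = x) → h x ≤ ((∫ y, g y ∂κ : ℝ) : EReal) := by
    intro hx
    have h1 : ∫ y, g y ∂κ = g x := by
      rw [integral_congr_ae (g := fun _ => g x) (hx.mono fun y hy => by simp [hy])]; simp
    rw [h1]
    obtain ⟨y, hy, rfl⟩ := (hhg.and hx).exists
    exact hy
  by_cases hL : ∃ z, z < x ∧ h z ≠ ⊤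
  swap
  · push Not at hL
    refine hdirac (ae_eq_mean_of_le_or_ge hInt hmean (Or.inr ?_))
    filter_upwards [hhg] with y hy
    by_contra hlt
    rw [hL y (not_le.1 hlt)] at hy
    exact EReal.coe_ne_top _ (top_le_iff.1 hy)
  by_cases hR : ∃ z, x < z ∧ h z ≠ ⊤
  swap
  · push Not at hR
    refine hdirac (ae_eq_mean_of_le_or_ge hInt hmean (Or.inl ?_))
    filter_upwards [hhg] with y hy
    by_contra hlt
    rw [hR y (not_le.1 hlt)] at hy
    exact EReal.coe_ne_top _ (top_le_iff.1 hy)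
  refine EReal.ge_of_forall_gt_iff_ge.1 fun r hr => ?_
  set H : ℝ → ℝ := fun y => (h y).toReal
  have hH : ∀ y, h y ≠ ⊤ → h y = (H y : EReal) := fun y hy =>
    (EReal.coe_toReal hy (hbot y)).symm
  have key : ∀ z y, z < x → x < y → h z ≠ ⊤ → h y ≠ ⊤ →
      (r - H z) / (x - z) ≤ (H y - r) / (y - x) := by
    intro z y hz hy hz' hy'
    have hzx : 0 < x - z := by linarith
    have hyx : 0 < y - x := by linarith
    have hyz : 0 < y - z := by linarith
    have := hc z y ((y - x) / (y - z)) (by positivity) (by rw [div_le_one hyz]; linarith)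
    have e : (y - x) / (y - z) * z + (1 - (y - x) / (y - z)) * y = x := by
      field_simp; ring
    rw [e, hH z hz', hH y hy'] at this
    have h2 : r ≤ (y - x) / (y - z) * H z + (1 - (y - x) / (y - z)) * H y := by
      exact_mod_cast hr.le.trans this
    have h3 : r * (y - z) ≤ (y - x) * H z + (x - z) * H y := by
      have := mul_le_mul_of_nonneg_right h2 hyz.le
      have e2 : ((y - x) / (y - z) * H z + (1 - (y - x) / (y - z)) * H y) * (y - z)
          = (y - x) * H z + (x - z) * H y := by field_simp; ring
      linarith
    rw [div_le_div_iff₀ hzx hyx]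
    nlinarith
  obtain ⟨z₀, hz₀, hz₀'⟩ := hL
  obtain ⟨y₀, hy₀, hy₀'⟩ := hR
  set S : Set ℝ := {s | ∃ z, z < x ∧ h z ≠ ⊤ ∧ s = (r - H z) / (x - z)}
  have hSne : S.Nonempty := ⟨_, z₀, hz₀, hz₀', rfl⟩
  have hSb : BddAbove S := ⟨(H y₀ - r) / (y₀ - x), by
    rintro _ ⟨z, hz, hz', rfl⟩; exact key z y₀ hz hy₀ hz' hy₀'⟩
  set c := sSup S
  have hsupp : ∀ y, h y ≠ ⊤ → r + c * (y - x) ≤ H y := by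
    intro y hy
    rcases lt_trichotomy y x with hlt | rfl | hgt
    · have h1 : (r - H y) / (x - y) ≤ c := le_csSup hSb ⟨y, hlt, hy, rfl⟩
      rw [div_le_iff₀ (by linarith)] at h1
      linarith
    · rw [hH y hy] at hr
      have : r < H y := by exact_mod_cast hr
      simpa using this.le
    · have h1 : c ≤ (H y - r) / (y - x) := csSup_le hSne (by
        rintro _ ⟨z, hz, hz', rfl⟩; exact key z y hz hgt hz' hy)
      rw [le_div_iff₀ (by linarith)] at h1
      linarith
  have hle : ∀ᵐ y ∂κ, r + c * (y - x) ≤ g y := by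
    filter_upwards [hhg] with y hy
    have hy' : h y ≠ ⊤ := fun e => EReal.coe_ne_top _ (top_le_iff.1 (e ▸ hy))
    rw [hH y hy'] at hy
    exact (hsupp y hy').trans (by exact_mod_cast hy)
  have hyx : Integrable (fun y => y - x) κ := hInt.sub (integrable_const _)
  have hI : ∫ y, (r + c * (y - x)) ∂κ = r := by
    rw [integral_add (integrable_const _) (hyx.const_mul c), integral_const_mul,
      integral_sub hInt (integrable_const _), hmean]
    simp
  have := integral_mono_ae ((integrable_const r).add (hyx.const_mul c)) hg hle
  have h5 : r ≤ ∫ y, g y ∂κ := by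
    rw [← hI]; exact this
  exact_mod_cast h5

lemma IsMartingaleCoupling.integrable_fst {Q : Measure (ℝ × ℝ)} {μ₁ μ₂ : Measure ℝ}
    (hQ : IsMartingaleCoupling Q μ₁ μ₂) {f : ℝ → ℝ} (hf : Integrable f μ₁) :
    Integrable (fun p : ℝ × ℝ => f p.1) Q := by
  obtain ⟨-, rfl, -, -⟩ := hQ
  exact hf.comp_measurable measurable_fst

lemma IsMartingaleCoupling.integrable_snd {Q : Measure (ℝ × ℝ)} {μ₁ μ₂ : Measure ℝ}
    (hQ : IsMartingaleCoupling Q μ₁ μ₂) {f : ℝ → ℝ} (hf : Integrable f μ₂) :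
    Integrable (fun p : ℝ × ℝ => f p.2) Q := by
  obtain ⟨-, -, rfl, -⟩ := hQ
  exact hf.comp_measurable measurable_snd

lemma IsMartingaleCoupling.integral_fst {Q : Measure (ℝ × ℝ)} {μ₁ μ₂ : Measure ℝ}
    (hQ : IsMartingaleCoupling Q μ₁ μ₂) {f : ℝ → ℝ} (hf : Integrable f μ₁) :
    ∫ p, f p.1 ∂Q = ∫ x, f x ∂μ₁ := by
  obtain ⟨-, rfl, -, -⟩ := hQ
  exact (integral_map measurable_fst.aemeasurable hf.1).symm

lemma IsMartingaleCoupling.integral_snd {Q : Measure (ℝ × ℝ)} {μ₁ μ₂ : Measure ℝ}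
    (hQ : IsMartingaleCoupling Q μ₁ μ₂) {f : ℝ → ℝ} (hf : Integrable f μ₂) :
    ∫ p, f p.2 ∂Q = ∫ x, f x ∂μ₂ := by
  obtain ⟨-, -, rfl, -⟩ := hQ
  exact (integral_map measurable_snd.aemeasurable hf.1).symm

/-- The linear growth weight `1 + |s₁| + |s₂|`. -/
def weight (p : ℝ × ℝ) : ℝ := 1 + |p.1| + |p.2|

lemma one_le_weight (p : ℝ × ℝ) : 1 ≤ weight p := by
  have := abs_nonneg p.1
  have := abs_nonneg p.2
  unfold weight
  linarith

lemma continuous_weight : Continuous weight := by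
  unfold weight
  fun_prop

lemma IsMartingaleCoupling.integrable_weight {Q : Measure (ℝ × ℝ)} {μ₁ μ₂ : Measure ℝ}
    (hQ : IsMartingaleCoupling Q μ₁ μ₂) (hmom₁ : Integrable (fun x : ℝ => x) μ₁)
    (hmom₂ : Integrable (fun x : ℝ => x) μ₂) : Integrable weight Q := by
  have := hQ.1
  exact ((integrable_const _).add (hQ.integrable_fst hmom₁.abs)).add
    (hQ.integrable_snd hmom₂.abs)

/-- The conditional mean of the second coordinate given the first one is the first one. -/
lemma IsMartingaleCoupling.ae_condKernel {Q : Measure (ℝ × ℝ)} {μ₁ μ₂ : Measure ℝ}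
    (hQ : IsMartingaleCoupling Q μ₁ μ₂) [IsProbabilityMeasure Q]
    (hmom₁ : Integrable (fun x : ℝ => x) μ₁) (hmom₂ : Integrable (fun x : ℝ => x) μ₂) :
    ∀ᵐ x ∂μ₁, Integrable (fun y => y) (Q.condKernel x) ∧ ∫ y, y ∂(Q.condKernel x) = x := by
  have hfst : Q.fst = μ₁ := hQ.2.1
  have hi1 : Integrable (fun p : ℝ × ℝ => p.1) Q := hQ.integrable_fst hmom₁
  have hi2 : Integrable (fun p : ℝ × ℝ => p.2) Q := hQ.integrable_snd hmom₂
  have hd : Integrable (fun p : ℝ × ℝ => p.2 - p.1) Q := hi2.sub hi1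
  have hzero : (fun x => ∫ y, (y - x) ∂(Q.condKernel x)) =ᵐ[μ₁] 0 := by
    refine Integrable.ae_eq_zero_of_forall_setIntegral_eq_zero ?_ ?_
    · rw [← hfst]; exact hd.integral_condKernel
    · intro s hs _
      rw [← hfst, Measure.setIntegral_condKernel_univ_right (f := fun p => p.2 - p.1) hs
        hd.integrableOn, ← integral_indicator (hs.prod MeasurableSet.univ)]
      have := hQ.2.2.2 (s.indicator 1) (measurable_one.indicator hs) ⟨1, fun x => by
        by_cases hx : x ∈ s <;> simp [hx]⟩
      rw [← this]
      congr 1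
      ext p
      by_cases hp : p.1 ∈ s <;> simp [Set.indicator, hp]
  have hIntSnd := hi2.condKernel_ae
  rw [hfst] at hIntSnd
  filter_upwards [hzero, hIntSnd] with x hx hx2
  refine ⟨hx2, ?_⟩
  rw [integral_sub hx2 (integrable_const _)] at hx
  simp at hx
  linarith

lemma weak_duality {Φ : ℝ × ℝ → EReal} (hΦ : Measurable Φ) {K : ℝ}
    (hK : ∀ p, ((-(K * weight p) : ℝ) : EReal) ≤ Φ p) {μ₁ μ₂ : Measure ℝ}
    (hmom₁ : Integrable (fun x : ℝ => x) μ₁) (hmom₂ : Integrable (fun x : ℝ => x) μ₂)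
    {Q : Measure (ℝ × ℝ)} (hQ : IsMartingaleCoupling Q μ₁ μ₂) {u₂ : ℝ → ℝ}
    (hu₂ : Integrable u₂ μ₂) :
    eInt (fun s₁ => convexEnvelope (fun s₂ => Φ (s₁, s₂) - ((u₂ s₂ : ℝ) : EReal)) s₁) μ₁ +
      ((∫ s, u₂ s ∂μ₂ : ℝ) : EReal) ≤ eInt Φ Q := by
  rcases eq_or_ne (eInt Φ Q) ⊤ with htop | htop
  · rw [htop]; exact le_top
  have := hQ.1
  have hfst : Q.fst = μ₁ := hQ.2.1
  obtain ⟨hφ, hφe⟩ := integrable_toReal_of_eInt_lt_top hΦ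
    ((hQ.integrable_weight hmom₁ hmom₂).const_mul K).neg hK htop.lt_top
  set φ : ℝ × ℝ → ℝ := fun p => (Φ p).toReal with hφdef
  set g : ℝ × ℝ → ℝ := fun p => φ p - u₂ p.2 with hgdef
  have hg : Integrable g Q := hφ.sub (hQ.integrable_snd hu₂)
  have hgc := hg.condKernel_ae
  have hR := hg.integral_condKernel
  have hRint : ∫ x, ∫ y, g (x, y) ∂(Q.condKernel x) ∂Q.fst = ∫ p, g p ∂Q :=
    Measure.integral_condKernel hg
  rw [← Q.disintegrate Q.condKernel] at hφe
  have hφe' := Measure.ae_ae_of_ae_compProd hφe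
  rw [hfst] at hgc hR hRint hφe'
  have hle : eInt (fun s₁ => convexEnvelope (fun s₂ => Φ (s₁, s₂) - ((u₂ s₂ : ℝ) : EReal)) s₁) μ₁
      ≤ eInt (fun x => ((∫ y, g (x, y) ∂(Q.condKernel x) : ℝ) : EReal)) μ₁ := by
    refine eInt_mono_ae ?_
    filter_upwards [hQ.ae_condKernel hmom₁ hmom₂, hgc, hφe'] with x hx hgx hφx
    refine iSup_le fun ⟨h, hc, hhg⟩ => hc.le_integral hx.1 hx.2 hgx ?_
    filter_upwards [hφx] with y hy
    refine (hhg y).trans (le_of_eq ?_)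
    change Φ (x, y) - (u₂ y : EReal) = _
    rw [hy]
    simp [hgdef, hφdef]
  have hfinal : ∫ p, g p ∂Q = ∫ p, φ p ∂Q - ∫ s, u₂ s ∂μ₂ := by
    rw [← hQ.integral_snd hu₂]
    exact integral_sub hφ (hQ.integrable_snd hu₂)
  have hΦint : eInt Φ Q = ((∫ p, φ p ∂Q : ℝ) : EReal) := by
    rw [← eInt_coe hφ]
    rw [Q.disintegrate Q.condKernel] at hφe
    exact eInt_congr_ae hφe
  rw [eInt_coe hR, hRint, hfinal] at hle
  calc _ ≤ ((∫ p, φ p ∂Q - ∫ s, u₂ s ∂μ₂ : ℝ) : EReal) + ((∫ s, u₂ s ∂μ₂ : ℝ) : EReal) :=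
        add_le_add_left hle _
    _ = eInt Φ Q := by
        rw [hΦint, ← EReal.coe_add]
        simp

/-- Functions of at most linear growth on the plane. -/
def HasLinearGrowth (F : ℝ × ℝ → ℝ) : Prop := ∃ C, ∀ p, |F p| ≤ C * weight p

/-- The space of functions of at most linear growth on the plane. -/
def linearGrowthSpace : Submodule ℝ (ℝ × ℝ → ℝ) where
  carrier := {F | HasLinearGrowth F}
  zero_mem' := ⟨0, fun p => by simp⟩
  add_mem' := by
    rintro F G ⟨C, hC⟩ ⟨D, hD⟩
    refine ⟨C + D, fun p => ?_⟩
    calc |F p + G p| ≤ |F p| + |G p| := abs_add_le _ _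
      _ ≤ (C + D) * weight p := by linarith [hC p, hD p]
  smul_mem' := by
    rintro c F ⟨C, hC⟩
    refine ⟨|c| * C, fun p => ?_⟩
    simp only [Pi.smul_apply, smul_eq_mul, abs_mul, mul_assoc]
    exact mul_le_mul_of_nonneg_left (hC p) (abs_nonneg c)

/-- `F` is superhedged at cost `v` by static positions in each coordinate, a trading strategy,
and `t` units of a minorant of `Φ`, each unit costing `d`. -/
def IsHedge (Φ : ℝ × ℝ → EReal) (μ₁ μ₂ : Measure ℝ) (d : ℝ) (F : ℝ × ℝ → ℝ) (v : ℝ) : Prop :=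
  ∃ (u₁ u₂ Δ : ℝ → ℝ) (t : ℝ) (G : ℝ × ℝ → ℝ), Integrable u₁ μ₁ ∧ Integrable u₂ μ₂ ∧
    Measurable Δ ∧ (∃ C, ∀ x, |Δ x| ≤ C) ∧ 0 ≤ t ∧ (∀ p, (G p : EReal) ≤ Φ p) ∧
    (∀ p, F p ≤ u₁ p.1 + u₂ p.2 + Δ p.1 * (p.2 - p.1) + t * G p) ∧
    v = ∫ x, u₁ x ∂μ₁ + ∫ x, u₂ x ∂μ₂ + t * d

lemma IsHedge.smul {Φ : ℝ × ℝ → EReal} {μ₁ μ₂ : Measure ℝ} {d : ℝ} {F : ℝ × ℝ → ℝ} {v : ℝ}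
    (h : IsHedge Φ μ₁ μ₂ d F v) {c : ℝ} (hc : 0 ≤ c) :
    IsHedge Φ μ₁ μ₂ d (c • F) (c * v) := by
  obtain ⟨u₁, u₂, Δ, t, G, h₁, h₂, hΔ, ⟨C, hC⟩, ht, hG, hF, rfl⟩ := h
  refine ⟨fun x => c * u₁ x, fun x => c * u₂ x, fun x => c * Δ x, c * t, G, h₁.const_mul c,
    h₂.const_mul c, hΔ.const_mul c, ⟨c * C, fun x => ?_⟩, mul_nonneg hc ht, hG, fun p => ?_, ?_⟩
  · rw [abs_mul, abs_of_nonneg hc]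
    exact mul_le_mul_of_nonneg_left (hC x) hc
  · have := mul_le_mul_of_nonneg_left (hF p) hc
    simp only [Pi.smul_apply, smul_eq_mul]
    linarith
  · rw [integral_const_mul, integral_const_mul]
    ring

lemma IsHedge.add {Φ : ℝ × ℝ → EReal} {μ₁ μ₂ : Measure ℝ} {d : ℝ} {F F' : ℝ × ℝ → ℝ} {v v' : ℝ}
    (h : IsHedge Φ μ₁ μ₂ d F v) (h' : IsHedge Φ μ₁ μ₂ d F' v') :
    IsHedge Φ μ₁ μ₂ d (F + F') (v + v') := by
  obtain ⟨u₁, u₂, Δ, t, G, h₁, h₂, hΔ, ⟨C, hC⟩, ht, hG, hF, rfl⟩ := h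
  obtain ⟨u₁', u₂', Δ', t', G', h₁', h₂', hΔ', ⟨C', hC'⟩, ht', hG', hF', rfl⟩ := h'
  refine ⟨fun x => u₁ x + u₁' x, fun x => u₂ x + u₂' x, fun x => Δ x + Δ' x, t + t',
    fun p => max (G p) (G' p), h₁.add h₁', h₂.add h₂', hΔ.add hΔ', ⟨C + C', fun x => ?_⟩,
    add_nonneg ht ht', fun p => ?_, fun p => ?_, ?_⟩
  · exact (abs_add_le _ _).trans (add_le_add (hC x) (hC' x))
  · rcases max_cases (G p) (G' p) with h | h <;> simp only [h.1]
    exacts [hG p, hG' p]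
  · have e1 := mul_le_mul_of_nonneg_left (le_max_left (G p) (G' p)) ht
    have e2 := mul_le_mul_of_nonneg_left (le_max_right (G p) (G' p)) ht'
    simp only [Pi.add_apply]
    linarith [hF p, hF' p]
  · rw [integral_add h₁ h₁', integral_add h₂ h₂']
    ring

/-- Static and dynamic positions alone give hedges. -/
lemma IsHedge.of_le {Φ : ℝ × ℝ → EReal} {K : ℝ}
    (hK : ∀ p, ((-(K * weight p) : ℝ) : EReal) ≤ Φ p) {μ₁ μ₂ : Measure ℝ} (d : ℝ)
    {F : ℝ × ℝ → ℝ} {u₁ u₂ Δ : ℝ → ℝ} (h₁ : Integrable u₁ μ₁) (h₂ : Integrable u₂ μ₂)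
    (hΔ : Measurable Δ) (hΔb : ∃ C, ∀ x, |Δ x| ≤ C)
    (hF : ∀ p, F p ≤ u₁ p.1 + u₂ p.2 + Δ p.1 * (p.2 - p.1)) :
    IsHedge Φ μ₁ μ₂ d F (∫ x, u₁ x ∂μ₁ + ∫ x, u₂ x ∂μ₂) :=
  ⟨u₁, u₂, Δ, 0, fun p => -(K * weight p), h₁, h₂, hΔ, hΔb, le_rfl, hK,
    fun p => by simpa using hF p, by simp⟩

lemma IsMartingaleCoupling.integral_position {Q : Measure (ℝ × ℝ)} {μ₁ μ₂ : Measure ℝ}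
    (hQ : IsMartingaleCoupling Q μ₁ μ₂) (hmom₁ : Integrable (fun x : ℝ => x) μ₁)
    (hmom₂ : Integrable (fun x : ℝ => x) μ₂) {u₁ u₂ Δ : ℝ → ℝ} (h₁ : Integrable u₁ μ₁)
    (h₂ : Integrable u₂ μ₂) (hΔ : Measurable Δ) (hΔb : ∃ C, ∀ x, |Δ x| ≤ C) :
    Integrable (fun p : ℝ × ℝ => u₁ p.1 + u₂ p.2 + Δ p.1 * (p.2 - p.1)) Q ∧
    ∫ p, (u₁ p.1 + u₂ p.2 + Δ p.1 * (p.2 - p.1)) ∂Q = ∫ x, u₁ x ∂μ₁ + ∫ x, u₂ x ∂μ₂ := by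
  have i12 : Integrable (fun p : ℝ × ℝ => u₁ p.1 + u₂ p.2) Q :=
    (hQ.integrable_fst h₁).add (hQ.integrable_snd h₂)
  obtain ⟨C, hC⟩ := hΔb
  have i3 : Integrable (fun p : ℝ × ℝ => Δ p.1 * (p.2 - p.1)) Q :=
    ((hQ.integrable_snd hmom₂).sub (hQ.integrable_fst hmom₁)).bdd_mul
      (hΔ.comp measurable_fst).aestronglyMeasurable (ae_of_all _ fun p => hC p.1)
  refine ⟨i12.add i3, ?_⟩
  rw [integral_add i12 i3, integral_add (hQ.integrable_fst h₁) (hQ.integrable_snd h₂),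
    hQ.integral_fst h₁, hQ.integral_snd h₂, hQ.2.2.2 Δ hΔ ⟨C, hC⟩, add_zero]

/-- The cost of a hedge is bounded below as soon as `d` dominates all dual values. -/
lemma IsHedge.neg_mul_le {Φ : ℝ × ℝ → EReal} {μ₁ μ₂ : Measure ℝ}
    (hmom₁ : Integrable (fun x : ℝ => x) μ₁) (hmom₂ : Integrable (fun x : ℝ => x) μ₂)
    {Q : Measure (ℝ × ℝ)} (hQ : IsMartingaleCoupling Q μ₁ μ₂) {d : ℝ}
    (hd : ∀ u₁ u₂ Δ : ℝ → ℝ, Integrable u₁ μ₁ → Integrable u₂ μ₂ → Measurable Δ →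
      (∃ C, ∀ x, |Δ x| ≤ C) →
      (∀ p : ℝ × ℝ, ((u₁ p.1 + u₂ p.2 + Δ p.1 * (p.2 - p.1) : ℝ) : EReal) ≤ Φ p) →
      ∫ x, u₁ x ∂μ₁ + ∫ x, u₂ x ∂μ₂ ≤ d)
    {F : ℝ × ℝ → ℝ} {C : ℝ} (hFC : ∀ p, |F p| ≤ C * weight p) {v : ℝ}
    (h : IsHedge Φ μ₁ μ₂ d F v) : -(C * ∫ p, weight p ∂Q) ≤ v := by
  obtain ⟨u₁, u₂, Δ, t, G, h₁, h₂, hΔ, ⟨B, hB⟩, ht, hG, hF, rfl⟩ := h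
  have hprob := hQ.1
  have hw := hQ.integrable_weight hmom₁ hmom₂
  have hlow : ∀ p, -(C * weight p) ≤ F p := fun p => neg_le_of_abs_le (hFC p)
  rcases ht.eq_or_lt with rfl | ht
  · obtain ⟨hi, he⟩ := hQ.integral_position hmom₁ hmom₂ h₁ h₂ hΔ ⟨B, hB⟩
    rw [← integral_const_mul, ← integral_neg, zero_mul, add_zero, ← he]
    refine integral_mono (hw.const_mul C).neg hi fun p => ?_
    have := hF p
    have := hlow p
    simp only
    linarith
  · have i1 : Integrable (fun x => -(C * (1 + |x|)) - u₁ x) μ₁ := by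
      have : IsProbabilityMeasure μ₁ := hQ.2.1 ▸
        Measure.isProbabilityMeasure_map measurable_fst.aemeasurable
      exact (((integrable_const _).add hmom₁.abs).const_mul C).neg.sub h₁
    have i2 : Integrable (fun x => -(C * |x|) - u₂ x) μ₂ := (hmom₂.abs.const_mul C).neg.sub h₂
    have hW := hQ.integral_position hmom₁ hmom₂ i1 i2 measurable_zero ⟨0, by simp⟩
    have hval := hd (fun x => t⁻¹ * (-(C * (1 + |x|)) - u₁ x))
      (fun x => t⁻¹ * (-(C * |x|) - u₂ x)) (fun x => t⁻¹ * (- Δ x)) (i1.const_mul _)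
      (i2.const_mul _) (hΔ.neg.const_mul _) ⟨|t⁻¹| * B, fun x => by
        rw [abs_mul, abs_neg]; exact mul_le_mul_of_nonneg_left (hB x) (abs_nonneg _)⟩ fun p => by
        refine le_trans ?_ (hG p)
        rw [EReal.coe_le_coe_iff]
        have e : t⁻¹ * (-(C * (1 + |p.1|)) - u₁ p.1) + t⁻¹ * (-(C * |p.2|) - u₂ p.2) +
            t⁻¹ * (-Δ p.1) * (p.2 - p.1) =
            t⁻¹ * (-(C * weight p) - u₁ p.1 - u₂ p.2 - Δ p.1 * (p.2 - p.1)) := by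
          unfold weight; ring
        rw [e, inv_mul_le_iff₀ ht]
        linarith [hF p, hlow p]
    rw [integral_const_mul, integral_const_mul, ← mul_add, inv_mul_le_iff₀ ht, ← hW.2] at hval
    have hsplit : ∫ p, ((-(C * (1 + |p.1|)) - u₁ p.1) + (-(C * |p.2|) - u₂ p.2) +
        (0 : ℝ → ℝ) p.1 * (p.2 - p.1)) ∂Q =
        -(C * ∫ p, weight p ∂Q) - (∫ x, u₁ x ∂μ₁ + ∫ x, u₂ x ∂μ₂) := by
      obtain ⟨hi, he⟩ := hQ.integral_position hmom₁ hmom₂ h₁ h₂ measurable_zero ⟨0, by simp⟩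
      have hCw : Integrable (fun p => -(C * weight p)) Q := (hw.const_mul C).neg
      rw [← he, ← integral_const_mul, ← integral_neg, ← integral_sub hCw hi]
      congr 1
      ext p
      simp only [weight, Pi.zero_apply, zero_mul, add_zero]
      ring
    linarith [hsplit ▸ hval]

/-- Hahn–Banach: a linear functional dominated by the superhedging cost. -/
lemma exists_linear_le_hedge {Φ : ℝ × ℝ → EReal} {K : ℝ}
    (hK : ∀ p, ((-(K * weight p) : ℝ) : EReal) ≤ Φ p) {μ₁ μ₂ : Measure ℝ}
    [IsProbabilityMeasure μ₁]
    (hmom₁ : Integrable (fun x : ℝ => x) μ₁) (hmom₂ : Integrable (fun x : ℝ => x) μ₂)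
    {Q : Measure (ℝ × ℝ)} (hQ : IsMartingaleCoupling Q μ₁ μ₂) {d : ℝ}
    (hd : ∀ u₁ u₂ Δ : ℝ → ℝ, Integrable u₁ μ₁ → Integrable u₂ μ₂ → Measurable Δ →
      (∃ C, ∀ x, |Δ x| ≤ C) →
      (∀ p : ℝ × ℝ, ((u₁ p.1 + u₂ p.2 + Δ p.1 * (p.2 - p.1) : ℝ) : EReal) ≤ Φ p) →
      ∫ x, u₁ x ∂μ₁ + ∫ x, u₂ x ∂μ₂ ≤ d) :
    ∃ ℓ : (ℝ × ℝ → ℝ) →ₗ[ℝ] ℝ, ∀ F, HasLinearGrowth F → ∀ v, IsHedge Φ μ₁ μ₂ d F v → ℓ F ≤ v := by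
  set N : linearGrowthSpace → ℝ := fun F => sInf {v | IsHedge Φ μ₁ μ₂ d F v} with hN
  have hne : ∀ F : linearGrowthSpace, {v | IsHedge Φ μ₁ μ₂ d F v}.Nonempty := by
    rintro ⟨F, C, hC⟩
    refine ⟨_, IsHedge.of_le hK d (u₁ := fun x => C * (1 + |x|)) (u₂ := fun x => C * |x|)
      (Δ := 0) (((integrable_const _).add hmom₁.abs).const_mul C) (hmom₂.abs.const_mul C)
      measurable_zero ⟨0, by simp⟩ fun p => ?_⟩
    have := (le_abs_self _).trans (hC p)
    simp only [weight] at this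
    simp only [Pi.zero_apply]
    linarith
  have hbdd : ∀ F : linearGrowthSpace, BddBelow {v | IsHedge Φ μ₁ μ₂ d F v} := by
    rintro ⟨F, C, hC⟩
    exact ⟨_, fun v hv => IsHedge.neg_mul_le hmom₁ hmom₂ hQ hd hC hv⟩
  have hsmul : ∀ c : ℝ, 0 < c → ∀ F, N (c • F) ≤ c * N F := by
    intro c hc F
    rw [← div_le_iff₀' hc]
    refine le_csInf (hne F) fun v hv => ?_
    rw [div_le_iff₀' hc]
    exact csInf_le (hbdd _) (IsHedge.smul hv hc.le)
  obtain ⟨g, -, hg⟩ := exists_extension_of_le_sublinear (E := linearGrowthSpace)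
    (⟨⊥, 0⟩ : linearGrowthSpace →ₗ.[ℝ] ℝ) N
    (fun c hc F => le_antisymm (hsmul c hc F) (by
      have := hsmul c⁻¹ (inv_pos.2 hc) (c • F)
      rw [smul_smul, inv_mul_cancel₀ hc.ne', one_smul, inv_mul_eq_div, le_div_iff₀' hc] at this
      exact this))
    (fun F F' => by
      rw [← sub_le_iff_le_add]
      refine le_csInf (hne F) fun v hv => ?_
      rw [sub_le_comm]
      refine le_csInf (hne F') fun v' hv' => ?_
      rw [sub_le_iff_le_add']
      exact csInf_le (hbdd _) (IsHedge.add hv hv'))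
    (by
      rintro ⟨F, hF⟩
      obtain rfl : F = 0 := by simpa using hF
      change (0 : ℝ) ≤ _
      refine le_csInf (hne _) fun v hv => ?_
      simpa using IsHedge.neg_mul_le hmom₁ hmom₂ hQ hd (F := 0) (C := 0) (by simp) hv)
  obtain ⟨ℓ, hℓ⟩ := g.exists_extend
  refine ⟨ℓ, fun F hF v hv => ?_⟩
  have : ℓ F = g ⟨F, hF⟩ := by rw [← hℓ]; rfl
  rw [this]
  exact (hg _).trans (csInf_le (hbdd _) hv)

/-- A nonnegative lower semicontinuous function on a metric space is the limit from below of
bounded continuous functions. -/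
lemma exists_continuous_approx {X : Type*} [PseudoMetricSpace X] {Ψ : X → EReal}
    (hΨ : LowerSemicontinuous Ψ) (h0 : ∀ x, 0 ≤ Ψ x) :
    ∃ g : ℕ → X → ℝ, (∀ n, Continuous (g n)) ∧
      (∀ n x, 0 ≤ g n x ∧ g n x ≤ n ∧ (g n x : EReal) ≤ Ψ x) ∧
      ∀ x, ∀ a : ℝ, (a : EReal) < Ψ x → ∀ᶠ n in atTop, a ≤ g n x := by
  set θ : ℕ → X → ℝ := fun n y => (min (Ψ y) (n : ℝ)).toReal with hθ
  have hmin : ∀ n y, ((θ n y : ℝ) : EReal) = min (Ψ y) (n : ℝ) := fun n y =>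
    EReal.coe_toReal (ne_top_of_le_ne_top (EReal.coe_ne_top _) (min_le_right _ _))
      (ne_bot_of_le_ne_bot EReal.zero_ne_bot (le_min (h0 y) (by exact_mod_cast n.cast_nonneg)))
  have hθ0 : ∀ n y, 0 ≤ θ n y := fun n y => by
    have : (0 : EReal) ≤ (θ n y : ℝ) := by
      rw [hmin]; exact le_min (h0 y) (by exact_mod_cast n.cast_nonneg)
    exact_mod_cast this
  have hθn : ∀ n y, θ n y ≤ n := fun n y => by
    have : ((θ n y : ℝ) : EReal) ≤ ((n : ℝ) : EReal) := by rw [hmin]; exact min_le_right _ _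
    exact_mod_cast this
  have hbdd : ∀ (n : ℕ) (x : X), BddBelow (Set.range fun y => θ n y + n * dist x y) := fun n x =>
    ⟨0, by rintro _ ⟨y, rfl⟩; have := hθ0 n y; positivity⟩
  set g : ℕ → X → ℝ := fun n x => ⨅ y, (θ n y + n * dist x y) with hg
  have hgθ : ∀ n x, g n x ≤ θ n x := fun n x =>
    (ciInf_le (hbdd n x) x).trans (by simp)
  refine ⟨g, fun n => ?_, fun n x => ⟨?_, (hgθ n x).trans (hθn n x), ?_⟩, fun x a ha => ?_⟩
  · refine (LipschitzWith.of_le_add_mul (n : NNReal) fun x y => ?_).continuous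
    have : Nonempty X := ⟨x⟩
    rw [← sub_le_iff_le_add]
    refine le_ciInf fun z => ?_
    rw [sub_le_iff_le_add]
    refine (ciInf_le (hbdd n x) z).trans ?_
    have := mul_le_mul_of_nonneg_left (dist_triangle x y z) (Nat.cast_nonneg (α := ℝ) n)
    simp only [NNReal.coe_natCast]
    linarith
  · have : Nonempty X := ⟨x⟩
    exact le_ciInf fun y => by have := hθ0 n y; positivity
  · calc (g n x : EReal) ≤ (θ n x : ℝ) := by exact_mod_cast hgθ n x
      _ ≤ Ψ x := by rw [hmin]; exact min_le_left _ _
  · have : Nonempty X := ⟨x⟩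
    obtain ⟨δ, hδ, hball⟩ := Metric.eventually_nhds_iff.1 (hΨ x a ha)
    filter_upwards [tendsto_natCast_atTop_atTop.eventually_ge_atTop a,
      tendsto_natCast_atTop_atTop.eventually_ge_atTop (a / δ)] with n hn hn'
    refine le_ciInf fun y => ?_
    rcases lt_or_ge (dist y x) δ with hy | hy
    · have h1 : a ≤ θ n y := by
        have : (a : EReal) ≤ (θ n y : ℝ) := by
          rw [hmin]; exact le_min (hball hy).le (by exact_mod_cast hn)
        exact_mod_cast this
      have : 0 ≤ n * dist x y := by positivity
      linarith
    · rw [div_le_iff₀ hδ] at hn'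
      rw [dist_comm] at hy
      have := mul_le_mul_of_nonneg_left hy (Nat.cast_nonneg (α := ℝ) n)
      linarith [hθ0 n y]

/-- A continuous cutoff equal to `1` on the ball of radius `n` and to `0` off the ball of
radius `n + 1`. -/
def cutoff (n : ℕ) (p : ℝ × ℝ) : ℝ := max 0 (min 1 (n + 1 - ‖p‖))

lemma continuous_cutoff (n : ℕ) : Continuous (cutoff n) := by
  unfold cutoff
  fun_prop

lemma cutoff_nonneg (n : ℕ) (p : ℝ × ℝ) : 0 ≤ cutoff n p := le_max_left _ _

lemma cutoff_le_one (n : ℕ) (p : ℝ × ℝ) : cutoff n p ≤ 1 :=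
  max_le zero_le_one (min_le_left _ _)

lemma cutoff_eq_one {n : ℕ} {p : ℝ × ℝ} (h : ‖p‖ ≤ n) : cutoff n p = 1 := by
  rw [cutoff, min_eq_left (by linarith), max_eq_right zero_le_one]

lemma hasCompactSupport_cutoff (n : ℕ) : HasCompactSupport (cutoff n) := by
  refine HasCompactSupport.intro (isCompact_closedBall (0 : ℝ × ℝ) (n + 1)) fun p hp => ?_
  rw [mem_closedBall_zero_iff, not_le] at hp
  exact max_eq_left ((min_le_right _ _).trans (by linarith))

lemma tendsto_cutoff_mul (F : ℝ × ℝ → ℝ) (p : ℝ × ℝ) :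
    Tendsto (fun n => cutoff n p * F p) atTop (𝓝 (F p)) := by
  refine tendsto_const_nhds.congr' ?_
  filter_upwards [tendsto_natCast_atTop_atTop.eventually_ge_atTop ‖p‖] with n hn
  rw [cutoff_eq_one hn, one_mul]

lemma abs_cutoff_mul_le (n : ℕ) (F : ℝ × ℝ → ℝ) (p : ℝ × ℝ) : |cutoff n p * F p| ≤ |F p| := by
  rw [abs_mul, abs_of_nonneg (cutoff_nonneg n p)]
  exact mul_le_of_le_one_left (abs_nonneg _) (cutoff_le_one n p)

lemma HasLinearGrowth.cutoff_mul {F : ℝ × ℝ → ℝ} (hF : HasLinearGrowth F) (n : ℕ) :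
    HasLinearGrowth fun p => cutoff n p * F p := by
  obtain ⟨C, hC⟩ := hF
  exact ⟨C, fun p => (abs_cutoff_mul_le n F p).trans (hC p)⟩

lemma hasLinearGrowth_weight : HasLinearGrowth weight :=
  ⟨1, fun p => by rw [abs_of_nonneg (by linarith [one_le_weight p]), one_mul]⟩

lemma hasLinearGrowth_of_bounded {F : ℝ × ℝ → ℝ} {C : ℝ} (hF : ∀ p, |F p| ≤ C) :
    HasLinearGrowth F :=
  ⟨C, fun p => (hF p).trans (le_mul_of_one_le_right ((abs_nonneg _).trans (hF p))
    (one_le_weight p))⟩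

lemma HasLinearGrowth.of_hasCompactSupport {F : ℝ × ℝ → ℝ} (hc : Continuous F)
    (hs : HasCompactSupport F) : HasLinearGrowth F := by
  obtain ⟨C, hC⟩ := hs.exists_bound_of_continuous hc
  exact hasLinearGrowth_of_bounded hC

/-- Riesz representation for positive functionals on functions of linear growth that do not
charge infinity. -/
lemma exists_measure_of_functional {ℓ : (ℝ × ℝ → ℝ) →ₗ[ℝ] ℝ}
    (hmono : ∀ F F', HasLinearGrowth F → HasLinearGrowth F' → F ≤ F' → ℓ F ≤ ℓ F')
    (htail : ∀ F, HasLinearGrowth F →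
      Tendsto (fun n => ℓ fun p => cutoff n p * F p) atTop (𝓝 (ℓ F))) :
    ∃ Q : Measure (ℝ × ℝ), ∀ F, Continuous F → HasLinearGrowth F →
      Integrable F Q ∧ ∫ p, F p ∂Q = ℓ F := by
  let Λ : CompactlySupportedContinuousMap (ℝ × ℝ) ℝ →ₚ[ℝ] ℝ :=
    { toFun := fun g => ℓ g
      map_add' := fun g g' => by rw [← map_add]; rfl
      map_smul' := fun c g => by rw [RingHom.id_apply, ← map_smul]; rfl
      monotone' := fun g g' h => hmono _ _
        (.of_hasCompactSupport g.continuous g.hasCompactSupport)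
        (.of_hasCompactSupport g'.continuous g'.hasCompactSupport) h }
  set Q := RealRMK.rieszMeasure Λ
  have hcut : ∀ F, Continuous F → ∀ n,
      Integrable (fun p => cutoff n p * F p) Q ∧
        ∫ p, cutoff n p * F p ∂Q = ℓ fun p => cutoff n p * F p := by
    intro F hF n
    have hc : Continuous fun p => cutoff n p * F p := (continuous_cutoff n).mul hF
    have hs : HasCompactSupport fun p => cutoff n p * F p := (hasCompactSupport_cutoff n).mul_right
    exact ⟨hc.integrable_of_hasCompactSupport hs,
      RealRMK.integral_rieszMeasure Λ ⟨⟨_, hc⟩, hs⟩⟩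
  have hw0 : ∀ p, 0 ≤ weight p := fun p => by linarith [one_le_weight p]
  have hw : Integrable weight Q := by
    refine ⟨continuous_weight.aestronglyMeasurable, ?_⟩
    rw [hasFiniteIntegral_iff_ofReal (ae_of_all _ hw0)]
    calc ∫⁻ p, ENNReal.ofReal (weight p) ∂Q
        ≤ ∫⁻ p, liminf (fun n => ENNReal.ofReal (cutoff n p * weight p)) atTop ∂Q := by
          refine lintegral_mono fun p => ?_
          exact (ENNReal.tendsto_ofReal (tendsto_cutoff_mul weight p)).liminf_eq.ge
      _ ≤ liminf (fun n => ∫⁻ p, ENNReal.ofReal (cutoff n p * weight p) ∂Q) atTop :=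
          lintegral_liminf_le fun n =>
            ((continuous_cutoff n).mul continuous_weight).measurable.ennreal_ofReal
      _ ≤ ENNReal.ofReal (ℓ weight) := by
          refine liminf_le_of_le (by isBoundedDefault) fun b hb => ?_
          obtain ⟨n, hn⟩ := hb.exists
          refine hn.trans ?_
          rw [← ofReal_integral_eq_lintegral_ofReal (hcut _ continuous_weight n).1
            (ae_of_all _ fun p => mul_nonneg (cutoff_nonneg n p) (hw0 p)),
            (hcut _ continuous_weight n).2]
          refine ENNReal.ofReal_le_ofReal (hmono _ _ (hasLinearGrowth_weight.cutoff_mul n)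
            hasLinearGrowth_weight fun p => ?_)
          exact mul_le_of_le_one_left (hw0 p) (cutoff_le_one n p)
      _ < ⊤ := ENNReal.ofReal_lt_top
  refine ⟨Q, fun F hF hg => ?_⟩
  obtain ⟨C, hC⟩ := id hg
  have hi : Integrable F Q := (hw.const_mul C).mono' hF.aestronglyMeasurable
    (ae_of_all _ hC)
  refine ⟨hi, tendsto_nhds_unique ?_ (htail F hg)⟩
  simp_rw [← (hcut F hF _).2]
  exact tendsto_integral_of_dominated_convergence (fun p => |F p|)
    (fun n => (hcut F hF n).1.1) hi.abs
    (fun n => ae_of_all _ (abs_cutoff_mul_le n F))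
    (ae_of_all _ (tendsto_cutoff_mul F))

/-- The martingale property may be tested on bounded continuous functions. -/
lemma integral_mul_eq_zero_of_continuous {Q : Measure (ℝ × ℝ)} {D : ℝ × ℝ → ℝ}
    (hDm : Measurable D) (hD : Integrable D Q)
    (h : ∀ f : BoundedContinuousFunction ℝ ℝ, ∫ p, f p.1 * D p ∂Q = 0) {Δ : ℝ → ℝ}
    (hΔ : Measurable Δ) (hΔb : ∃ C, ∀ x, |Δ x| ≤ C) : ∫ p, Δ p.1 * D p ∂Q = 0 := by
  set ν : (ℝ × ℝ → ℝ) → Measure ℝ := fun E =>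
    (Q.withDensity fun p => ENNReal.ofReal (E p)).map Prod.fst with hν
  have hfin : ∀ E, Integrable E Q → IsFiniteMeasure (ν E) := fun E hE => by
    have := isFiniteMeasure_withDensity_ofReal hE.2
    exact Measure.isFiniteMeasure_map _ _
  have hInt : ∀ E, Measurable E → ∀ f : ℝ → ℝ, Measurable f →
      ∫ x, f x ∂(ν E) = ∫ p, f p.1 * max (E p) 0 ∂Q := by
    intro E hE f hf
    rw [integral_map measurable_fst.aemeasurable hf.aestronglyMeasurable,
      integral_withDensity_eq_integral_toReal_smul hE.ennreal_ofReal
        (ae_of_all _ fun _ => ENNReal.ofReal_lt_top)]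
    congr 1
    ext p
    rw [ENNReal.toReal_ofReal', smul_eq_mul, mul_comm]
  have hsub : ∀ f : ℝ → ℝ, Measurable f → (∃ C, ∀ x, |f x| ≤ C) →
      ∫ p, f p.1 * D p ∂Q = ∫ x, f x ∂(ν D) - ∫ x, f x ∂(ν (-D)) := by
    rintro f hf ⟨C, hC⟩
    have hbd : ∀ E, Integrable E Q → Integrable (fun p : ℝ × ℝ => f p.1 * max (E p) 0) Q :=
      fun E hE => hE.pos_part.bdd_mul
        (hf.comp measurable_fst).aestronglyMeasurable (ae_of_all _ fun p => hC p.1)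
    rw [hInt D hDm f hf, hInt (-D) hDm.neg f hf, ← integral_sub (hbd D hD) (hbd _ hD.neg)]
    congr 1
    ext p
    rw [← mul_sub, Pi.neg_apply, max_zero_sub_max_neg_zero_eq_self]
  have := hfin D hD
  have := hfin (-D) hD.neg
  have heq : ν D = ν (-D) := by
    refine ext_of_forall_integral_eq_of_IsFiniteMeasure fun f => ?_
    have := hsub f f.continuous.measurable ⟨‖f‖, fun x => f.norm_coe_le_norm x⟩
    rw [h f] at this
    linarith
  rw [hsub Δ hΔ hΔb, heq, sub_self]

/-- The tail of an affine function of `|x|` outside `[-n, n]`. -/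
def tail (n : ℕ) : ℝ → ℝ := {x : ℝ | (n : ℝ) < |x|}.indicator fun x => 1 + 2 * |x|

lemma tail_nonneg (n : ℕ) (x : ℝ) : 0 ≤ tail n x :=
  Set.indicator_nonneg (fun x _ => by positivity) x

lemma measurableSet_tail (n : ℕ) : MeasurableSet {x : ℝ | (n : ℝ) < |x|} :=
  measurableSet_lt measurable_const continuous_abs.measurable

lemma integrable_tail {μ : Measure ℝ} [IsProbabilityMeasure μ]
    (hmom : Integrable (fun x : ℝ => x) μ) (n : ℕ) : Integrable (tail n) μ :=
  ((integrable_const _).add (hmom.abs.const_mul 2)).indicator (measurableSet_tail n)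

lemma tendsto_integral_tail {μ : Measure ℝ} [IsProbabilityMeasure μ]
    (hmom : Integrable (fun x : ℝ => x) μ) :
    Tendsto (fun n => ∫ x, tail n x ∂μ) atTop (𝓝 0) := by
  rw [show (0 : ℝ) = ∫ _, (0 : ℝ) ∂μ by simp]
  refine tendsto_integral_of_dominated_convergence (fun x => 1 + 2 * |x|)
    (fun n => (integrable_tail hmom n).1) ((integrable_const _).add (hmom.abs.const_mul 2))
    (fun n => ae_of_all _ fun x => ?_) (ae_of_all _ fun x => ?_)
  · rw [Real.norm_of_nonneg (tail_nonneg n x)]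
    exact Set.indicator_le_self' (fun x _ => by positivity) x
  · refine tendsto_const_nhds.congr' ?_
    filter_upwards [tendsto_natCast_atTop_atTop.eventually_ge_atTop |x|] with n hn
    exact (Set.indicator_of_notMem (s := {x : ℝ | (n : ℝ) < |x|}) (not_lt.2 hn) _).symm

lemma one_sub_cutoff_mul_weight_le (n : ℕ) (p : ℝ × ℝ) :
    (1 - cutoff n p) * weight p ≤ tail n p.1 + tail n p.2 := by
  have t1 := tail_nonneg n p.1
  have t2 := tail_nonneg n p.2
  rcases le_or_gt ‖p‖ n with h | h
  · rw [cutoff_eq_one h]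
    linarith
  have hle : (1 - cutoff n p) * weight p ≤ weight p :=
    mul_le_of_le_one_left (by linarith [one_le_weight p]) (by linarith [cutoff_nonneg n p])
  refine hle.trans ?_
  rw [Prod.norm_def, Real.norm_eq_abs, Real.norm_eq_abs] at h
  rcases le_total |p.1| |p.2| with h' | h'
  · rw [max_eq_right h'] at h
    have : tail n p.2 = 1 + 2 * |p.2| :=
      Set.indicator_of_mem (s := {x : ℝ | (n : ℝ) < |x|}) h _
    unfold weight
    linarith
  · rw [max_eq_left h'] at h
    have : tail n p.1 = 1 + 2 * |p.1| :=
      Set.indicator_of_mem (s := {x : ℝ | (n : ℝ) < |x|}) h _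
    unfold weight
    linarith

lemma toENN_le_liminf {a : EReal} (ha : 0 ≤ a) {g : ℕ → ℝ}
    (h : ∀ r : ℝ, (r : EReal) < a → ∀ᶠ n in atTop, r ≤ g n) :
    toENN a ≤ liminf (fun n => ENNReal.ofReal (g n)) atTop := by
  refine le_of_forall_lt fun b hb => ?_
  obtain ⟨c, hbc, hc⟩ := exists_between hb
  refine hbc.trans_le (le_liminf_of_le (by isBoundedDefault) ?_)
  have hc' : ((c.toReal : ℝ) : EReal) < a := by
    rw [EReal.coe_ennreal_toReal hc.ne_top, ← EReal.coe_toENNReal ha]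
    exact EReal.coe_ennreal_lt_coe_ennreal_iff.2 hc
  filter_upwards [h _ hc'] with n hn
  rw [← ENNReal.ofReal_toReal hc.ne_top]
  exact ENNReal.ofReal_le_ofReal hn

/-- Fatou-type bound for the extended integral of a lower semicontinuous function of linear
lower growth in terms of its continuous minorants. -/
lemma eInt_le_of_continuous_minorants {Φ : ℝ × ℝ → EReal} (hlsc : LowerSemicontinuous Φ) {K : ℝ}
    (hK : ∀ p, ((-(K * weight p) : ℝ) : EReal) ≤ Φ p) {Q : Measure (ℝ × ℝ)}
    [IsProbabilityMeasure Q] (hw : Integrable weight Q) {d : ℝ}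
    (hd : ∀ F, Continuous F → HasLinearGrowth F → (∀ p, (F p : EReal) ≤ Φ p) →
      ∫ p, F p ∂Q ≤ d) : eInt Φ Q ≤ d := by
  set Ψ : ℝ × ℝ → EReal := fun p => Φ p + ((K * weight p : ℝ) : EReal) with hΨdef
  have hΨ : LowerSemicontinuous Ψ := by
    refine hlsc.add' (Continuous.lowerSemicontinuous ?_) fun p =>
      EReal.continuousAt_add (Or.inr (EReal.coe_ne_bot _)) (Or.inr (EReal.coe_ne_top _))
    exact continuous_coe_real_ereal.comp (continuous_weight.const_mul K)
  have hΨ0 : ∀ p, 0 ≤ Ψ p := fun p => by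
    calc (0 : EReal) = ((-(K * weight p) : ℝ) : EReal) + ((K * weight p : ℝ) : EReal) := by
          rw [← EReal.coe_add]; simp
      _ ≤ Ψ p := add_le_add_left (hK p) _
  obtain ⟨g, hgc, hgb, hgl⟩ := exists_continuous_approx hΨ hΨ0
  have hgi : ∀ n, Integrable (g n) Q := fun n =>
    (integrable_const (n : ℝ)).mono' (hgc n).aestronglyMeasurable
      (ae_of_all _ fun p => by rw [Real.norm_of_nonneg (hgb n p).1]; exact (hgb n p).2.1)
  have hbound : ∀ n, ∫ p, g n p ∂Q ≤ d + K * ∫ p, weight p ∂Q := by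
    intro n
    have := hd (fun p => g n p - K * weight p) ((hgc n).sub (continuous_weight.const_mul K))
      (linearGrowthSpace.sub_mem (x := g n) (y := K • weight)
        (hasLinearGrowth_of_bounded (C := n) fun p => by
          rw [abs_of_nonneg (hgb n p).1]; exact (hgb n p).2.1)
        (linearGrowthSpace.smul_mem K hasLinearGrowth_weight)) fun p => by
        rw [EReal.coe_sub]
        exact EReal.sub_le_of_le_add (hgb n p).2.2
    rw [integral_sub (hgi n) (hw.const_mul K), integral_const_mul] at this
    linarith
  have h0 : 0 ≤ d + K * ∫ p, weight p ∂Q :=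
    (integral_nonneg fun p => (hgb 0 p).1).trans (hbound 0)
  have hl : ∫⁻ p, toENN (Ψ p) ∂Q ≤ ENNReal.ofReal (d + K * ∫ p, weight p ∂Q) := by
    calc ∫⁻ p, toENN (Ψ p) ∂Q
        ≤ ∫⁻ p, liminf (fun n => ENNReal.ofReal (g n p)) atTop ∂Q :=
          lintegral_mono fun p => toENN_le_liminf (hΨ0 p) (hgl p)
      _ ≤ liminf (fun n => ∫⁻ p, ENNReal.ofReal (g n p) ∂Q) atTop :=
          lintegral_liminf_le fun n => (hgc n).measurable.ennreal_ofReal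
      _ ≤ ENNReal.ofReal (d + K * ∫ p, weight p ∂Q) := by
          refine liminf_le_of_le (by isBoundedDefault) fun b hb => ?_
          obtain ⟨n, hn⟩ := hb.exists
          refine hn.trans ?_
          rw [← ofReal_integral_eq_lintegral_ofReal (hgi n) (ae_of_all _ fun p => (hgb n p).1)]
          exact ENNReal.ofReal_le_ofReal (hbound n)
  have hΨle : eInt Ψ Q ≤ ((d + K * ∫ p, weight p ∂Q : ℝ) : EReal) := by
    have hneg : ∫⁻ p, toENN (-(Ψ p)) ∂Q = 0 := by
      refine lintegral_eq_zero_of_ae_eq_zero (ae_of_all _ fun p => ?_)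
      exact EReal.toENNReal_of_nonpos (EReal.neg_le_zero.2 (hΨ0 p))
    rw [eInt, hneg, EReal.coe_ennreal_zero, sub_zero]
    refine (EReal.coe_ennreal_le_coe_ennreal_iff.2 hl).trans (le_of_eq ?_)
    rw [EReal.coe_ennreal_ofReal, max_eq_left h0]
  obtain ⟨hψ, hψe⟩ := integrable_toReal_of_eInt_lt_top hΨ.measurable
    (integrable_zero _ ℝ Q) (by simpa using hΨ0) (hΨle.trans_lt (EReal.coe_lt_top _))
  have hΦe : ∀ᵐ p ∂Q, Φ p = (((Ψ p).toReal - K * weight p : ℝ) : EReal) := by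
    filter_upwards [hψe] with p hp
    rw [EReal.coe_sub, ← hp, hΨdef]
    exact EReal.add_sub_cancel_right.symm
  rw [eInt_congr_ae hψe, eInt_coe hψ, EReal.coe_le_coe_iff] at hΨle
  have hsub : Integrable (fun p => (Ψ p).toReal - K * weight p) Q := hψ.sub (hw.const_mul K)
  rw [eInt_congr_ae hΦe, eInt_coe hsub, EReal.coe_le_coe_iff,
    integral_sub hψ (hw.const_mul K), integral_const_mul]
  linarith

/-- If `d` dominates all dual values, some martingale coupling has cost at most `d`. -/
lemma exists_coupling_eInt_le {Φ : ℝ × ℝ → EReal} (hlsc : LowerSemicontinuous Φ) {K : ℝ}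
    (hK : ∀ p, ((-(K * weight p) : ℝ) : EReal) ≤ Φ p) {μ₁ μ₂ : Measure ℝ}
    [IsProbabilityMeasure μ₁] [IsProbabilityMeasure μ₂]
    (hmom₁ : Integrable (fun x : ℝ => x) μ₁) (hmom₂ : Integrable (fun x : ℝ => x) μ₂)
    {Q₀ : Measure (ℝ × ℝ)} (hQ₀ : IsMartingaleCoupling Q₀ μ₁ μ₂) {d : ℝ}
    (hd : ∀ u₁ u₂ Δ : ℝ → ℝ, Integrable u₁ μ₁ → Integrable u₂ μ₂ → Measurable Δ →
      (∃ C, ∀ x, |Δ x| ≤ C) →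
      (∀ p : ℝ × ℝ, ((u₁ p.1 + u₂ p.2 + Δ p.1 * (p.2 - p.1) : ℝ) : EReal) ≤ Φ p) →
      ∫ x, u₁ x ∂μ₁ + ∫ x, u₂ x ∂μ₂ ≤ d) :
    ∃ Q : Measure (ℝ × ℝ), IsMartingaleCoupling Q μ₁ μ₂ ∧ eInt Φ Q ≤ d := by
  obtain ⟨ℓ, hℓ⟩ := exists_linear_le_hedge hK hmom₁ hmom₂ hQ₀ hd
  have hmono : ∀ F F', HasLinearGrowth F → HasLinearGrowth F' → F ≤ F' → ℓ F ≤ ℓ F' := by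
    intro F F' hF hF' hle
    have := hℓ (F - F') (linearGrowthSpace.sub_mem hF hF') _
      (IsHedge.of_le hK d (u₁ := 0) (u₂ := 0) (Δ := 0) (integrable_zero _ _ _)
        (integrable_zero _ _ _) measurable_zero ⟨0, by simp⟩ fun p => by simpa using hle p)
    rw [map_sub] at this
    simp only [Pi.zero_apply, integral_zero, add_zero] at this
    linarith
  have hposition : ∀ u₁ u₂ Δ : ℝ → ℝ, Integrable u₁ μ₁ → Integrable u₂ μ₂ → Measurable Δ →
      (∃ C, ∀ x, |Δ x| ≤ C) → ∀ F : ℝ × ℝ → ℝ, HasLinearGrowth F →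
      (∀ p, F p = u₁ p.1 + u₂ p.2 + Δ p.1 * (p.2 - p.1)) →
      ℓ F = ∫ x, u₁ x ∂μ₁ + ∫ x, u₂ x ∂μ₂ := by
    rintro u₁ u₂ Δ h₁ h₂ hΔ ⟨C, hC⟩ F hF hFe
    refine le_antisymm (hℓ F hF _ (IsHedge.of_le hK d h₁ h₂ hΔ ⟨C, hC⟩ fun p => (hFe p).le)) ?_
    have := hℓ (-F) (linearGrowthSpace.neg_mem hF) _ (IsHedge.of_le hK d h₁.neg h₂.neg hΔ.neg
      ⟨C, fun x => by simpa using hC x⟩ fun p => by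
        simp only [Pi.neg_apply, hFe p]
        linarith)
    simp only [Pi.neg_apply, integral_neg, map_neg] at this
    linarith
  have htail : ∀ F, HasLinearGrowth F →
      Tendsto (fun n => ℓ fun p => cutoff n p * F p) atTop (𝓝 (ℓ F)) := by
    intro F hF
    obtain ⟨C, hC⟩ := id hF
    have hC0 : 0 ≤ C := by
      have := (abs_nonneg _).trans (hC (0, 0))
      simpa [weight] using this
    have hbound : ∀ n (G : ℝ × ℝ → ℝ), (∀ p, |G p| ≤ (1 - cutoff n p) * (C * weight p)) →
        ℓ G ≤ C * ∫ x, tail n x ∂μ₁ + C * ∫ x, tail n x ∂μ₂ := by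
      intro n G hG
      rw [← integral_const_mul, ← integral_const_mul]
      refine hℓ G ⟨C, fun p => (hG p).trans ?_⟩ _
        (IsHedge.of_le hK d (Δ := 0) ((integrable_tail hmom₁ n).const_mul C)
          ((integrable_tail hmom₂ n).const_mul C) measurable_zero ⟨0, by simp⟩ fun p => ?_)
      · exact mul_le_of_le_one_left (mul_nonneg hC0 (by linarith [one_le_weight p]))
          (by linarith [cutoff_nonneg n p])
      · have h1 := (le_abs_self _).trans (hG p)
        have h2 := mul_le_mul_of_nonneg_left (one_sub_cutoff_mul_weight_le n p) hC0
        simp only [Pi.zero_apply, zero_mul, add_zero]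
        linarith
    have hlim : Tendsto (fun n => C * ∫ x, tail n x ∂μ₁ + C * ∫ x, tail n x ∂μ₂) atTop (𝓝 0) := by
      simpa using ((tendsto_integral_tail hmom₁).const_mul C).add
        ((tendsto_integral_tail hmom₂).const_mul C)
    rw [tendsto_iff_dist_tendsto_zero]
    refine squeeze_zero (fun _ => dist_nonneg) (fun n => ?_) hlim
    have habs : ∀ p, |((fun p => cutoff n p * F p) - F) p| ≤ (1 - cutoff n p) * (C * weight p) := by
      intro p
      have e : ((fun p => cutoff n p * F p) - F) p = -((1 - cutoff n p) * F p) := by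
        simp only [Pi.sub_apply]; ring
      have h1 : 0 ≤ 1 - cutoff n p := by linarith [cutoff_le_one n p]
      rw [e, abs_neg, abs_mul, abs_of_nonneg h1]
      exact mul_le_mul_of_nonneg_left (hC p) h1
    rw [Real.dist_eq, ← map_sub]
    refine abs_le'.2 ⟨hbound n _ habs, ?_⟩
    rw [← map_neg]
    exact hbound n _ fun p => by rw [Pi.neg_apply, abs_neg]; exact habs p
  obtain ⟨Q, hQ⟩ := exists_measure_of_functional hmono htail
  have hbcf : ∀ f : BoundedContinuousFunction ℝ ℝ, ∀ x, |f x| ≤ ‖f‖ := fun f x =>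
    f.norm_coe_le_norm x
  have hone : HasLinearGrowth fun _ => (1 : ℝ) := hasLinearGrowth_of_bounded (C := 1) (by simp)
  have hprob : IsProbabilityMeasure Q := by
    have h1 := hQ (fun _ => 1) continuous_const hone
    have hQfin : IsFiniteMeasure Q := by
      rcases integrable_const_iff.1 h1.1 with h | h
      · exact absurd h one_ne_zero
      · exact h
    have h2 := hposition (fun _ => 1) 0 0 (integrable_const _) (integrable_zero _ _ _)
      measurable_zero ⟨0, by simp⟩ (fun _ => 1) hone (by simp)
    rw [h1.2.symm] at h2
    simp only [integral_const, probReal_univ, smul_eq_mul, mul_one, Pi.zero_apply,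
      mul_zero, add_zero] at h2
    exact ⟨by rw [← ENNReal.toReal_eq_one_iff]; exact h2⟩
  have hfst : Q.map Prod.fst = μ₁ := by
    have := Measure.isProbabilityMeasure_map (μ := Q) (f := Prod.fst) measurable_fst.aemeasurable
    refine ext_of_forall_integral_eq_of_IsFiniteMeasure fun f => ?_
    have hg : HasLinearGrowth fun p : ℝ × ℝ => f p.1 :=
      hasLinearGrowth_of_bounded fun p => hbcf f p.1
    rw [integral_map measurable_fst.aemeasurable f.continuous.aestronglyMeasurable,
      (hQ _ (by fun_prop) hg).2,
      hposition f 0 0 (f.integrable μ₁) (integrable_zero _ _ _) measurable_zero ⟨0, by simp⟩ _ hg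
        (by simp)]
    simp
  have hsnd : Q.map Prod.snd = μ₂ := by
    have := Measure.isProbabilityMeasure_map (μ := Q) (f := Prod.snd) measurable_snd.aemeasurable
    refine ext_of_forall_integral_eq_of_IsFiniteMeasure fun f => ?_
    have hg : HasLinearGrowth fun p : ℝ × ℝ => f p.2 :=
      hasLinearGrowth_of_bounded fun p => hbcf f p.2
    rw [integral_map measurable_snd.aemeasurable f.continuous.aestronglyMeasurable,
      (hQ _ (by fun_prop) hg).2,
      hposition 0 f 0 (integrable_zero _ _ _) (f.integrable μ₂) measurable_zero ⟨0, by simp⟩ _ hg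
        (by simp)]
    simp
  have hdiff : ∀ (f : ℝ → ℝ) (C : ℝ), (∀ x, |f x| ≤ C) →
      HasLinearGrowth fun p : ℝ × ℝ => f p.1 * (p.2 - p.1) := by
    intro f C hC
    refine ⟨C, fun p => ?_⟩
    rw [abs_mul]
    refine mul_le_mul (hC _) ?_ (abs_nonneg _) ((abs_nonneg _).trans (hC 0))
    have := abs_sub p.2 p.1
    unfold weight
    linarith
  have hmart : IsMartingaleCoupling Q μ₁ μ₂ := by
    refine ⟨hprob, hfst, hsnd, fun Δ hΔ hΔb => ?_⟩
    refine integral_mul_eq_zero_of_continuous (D := fun p => p.2 - p.1)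
      (measurable_snd.sub measurable_fst) ?_ (fun f => ?_) hΔ hΔb
    · have := (hQ (fun p => 1 * (p.2 - p.1)) (by fun_prop)
        (hdiff (fun _ => 1) 1 (by simp))).1
      simpa using this
    · have hg := hdiff f _ (hbcf f)
      rw [(hQ _ (by fun_prop) hg).2, hposition 0 0 f (integrable_zero _ _ _)
        (integrable_zero _ _ _) f.continuous.measurable ⟨‖f‖, hbcf f⟩ _ hg (by simp)]
      simp
  refine ⟨Q, hmart, eInt_le_of_continuous_minorants hlsc hK
    (hmart.integrable_weight hmom₁ hmom₂) fun F hF hFg hFΦ => ?_⟩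
  rw [(hQ F hF hFg).2]
  exact hℓ F hFg d ⟨0, 0, 0, 1, F, integrable_zero _ _ _, integrable_zero _ _ _,
    measurable_zero, ⟨0, by simp⟩, zero_le_one, hFΦ, fun p => by simp, by simp⟩

lemma EConvexOn.affine (a b x₀ : ℝ) : EConvexOn fun y => ((a + b * (y - x₀) : ℝ) : EReal) := by
  intro x y t _ _
  rw [← EReal.coe_mul, ← EReal.coe_mul, ← EReal.coe_add, EReal.coe_le_coe_iff]
  exact le_of_eq (by ring)

lemma coe_le_convexEnvelope {g : ℝ → EReal} {x a b : ℝ}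
    (h : ∀ y, ((a + b * (y - x) : ℝ) : EReal) ≤ g y) : (a : EReal) ≤ convexEnvelope g x := by
  refine le_trans (le_of_eq ?_)
    (le_iSup (fun h : {h : ℝ → EReal // EConvexOn h ∧ ∀ y, h y ≤ g y} => (h : ℝ → EReal) x)
      ⟨_, EConvexOn.affine a b x, h⟩)
  simp

end MOT2

/-- **Proposition 4.4 (c-convex duality).** Let `Φ : ℝ² → (-∞, ∞]` be lower
semi-continuous with `Φ(s₁, s₂) ≥ -K (1 + |s₁| + |s₂|)`, let `μ₁, μ₂` be Borel probability
measures with finite first moments and assume some `Q ∈ M(μ₁, μ₂)` has `∫ Φ dQ < ∞`. Then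
`P = sup {∫ (Φ(s₁, ·) - u₂)**(s₁) dμ₁(s₁) + ∫ u₂ dμ₂}`, the supremum running over all
`μ₂`-integrable `u₂ : ℝ → ℝ`, where `(Φ(s₁, ·) - u₂)**` denotes the convex envelope in the
second variable. -/
theorem c_convex_duality (Φ : ℝ × ℝ → EReal) (hlsc : LowerSemicontinuous Φ)
    (K : ℝ) (hK : ∀ s₁ s₂ : ℝ, ((-(K * (1 + |s₁| + |s₂|)) : ℝ) : EReal) ≤ Φ (s₁, s₂))
    (μ₁ μ₂ : Measure ℝ)
    (hprob₁ : IsProbabilityMeasure μ₁) (hprob₂ : IsProbabilityMeasure μ₂)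
    (hmom₁ : Integrable (fun x : ℝ => x) μ₁) (hmom₂ : Integrable (fun x : ℝ => x) μ₂)
    (hfin : ∃ Q : Measure (ℝ × ℝ), MOT2.IsMartingaleCoupling Q μ₁ μ₂ ∧
      MOT2.eInt Φ Q < ⊤) :
    sInf {v : EReal | ∃ Q : Measure (ℝ × ℝ),
        MOT2.IsMartingaleCoupling Q μ₁ μ₂ ∧ v = MOT2.eInt Φ Q} =
      sSup {v : EReal | ∃ u₂ : ℝ → ℝ, Integrable u₂ μ₂ ∧
        v = MOT2.eInt
              (fun s₁ => MOT2.convexEnvelope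
                (fun s₂ => Φ (s₁, s₂) - ((u₂ s₂ : ℝ) : EReal)) s₁) μ₁ +
            ((∫ s, u₂ s ∂μ₂ : ℝ) : EReal)} := by
  have hK' : ∀ p, ((-(K * MOT2.weight p) : ℝ) : EReal) ≤ Φ p := fun p => hK p.1 p.2
  apply le_antisymm
  · refine EReal.le_of_forall_lt_iff_le.1 fun d hd => ?_
    obtain ⟨Q₀, hQ₀, -⟩ := hfin
    obtain ⟨Q, hQ, hQd⟩ := MOT2.exists_coupling_eInt_le hlsc hK' hmom₁ hmom₂ hQ₀ (d := d) <| by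
      intro u₁ u₂ Δ h₁ h₂ _ _ hu
      have hle : ((∫ x, u₁ x ∂μ₁ : ℝ) : EReal) ≤ MOT2.eInt (fun s₁ => MOT2.convexEnvelope
          (fun s₂ => Φ (s₁, s₂) - ((u₂ s₂ : ℝ) : EReal)) s₁) μ₁ := by
        rw [← MOT2.eInt_coe h₁]
        refine MOT2.eInt_mono_ae (ae_of_all _ fun s₁ => ?_)
        refine MOT2.coe_le_convexEnvelope (b := Δ s₁) fun s₂ => ?_
        rw [EReal.le_sub_iff_add_le (Or.inl (EReal.coe_ne_bot _))
          (Or.inl (EReal.coe_ne_top _)), ← EReal.coe_add]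
        convert hu (s₁, s₂) using 2
        ring
      have hsup := (add_le_add_left hle ((∫ x, u₂ x ∂μ₂ : ℝ) : EReal)).trans
        ((le_sSup (by exact ⟨u₂, h₂, rfl⟩)).trans hd.le)
      exact_mod_cast hsup
    exact (sInf_le (by exact ⟨Q, hQ, rfl⟩)).trans hQd
  · refine sSup_le ?_
    rintro _ ⟨u₂, hu₂, rfl⟩
    refine le_sInf ?_
    rintro _ ⟨Q, hQ, rfl⟩
    exact MOT2.weak_duality hlsc.measurable hK' hmom₁ hmom₂ hQ hu₂
end
end

section
/- Let f : ℝ → ℝ be bounded and continuous, let μ be a Borel probability measure on ℝ with finite first moment, and let ε > 0. Then there exists a function u ∈ 𝒮 such that u ≤ f pointwise and ∫ (f − u) dμ < ε. -/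
open MeasureTheory
open scoped BigOperators

noncomputable section

namespace MOT

/-- The class `𝒮` of functions `u(x) = a + b x + ∑ᵢ cᵢ (x - kᵢ)₊`, i.e. finite linear
combinations of call payoffs, a bond and a stock position. -/
def InS (u : ℝ → ℝ) : Prop :=
  ∃ (a b : ℝ) (m : ℕ) (c k : Fin m → ℝ),
    ∀ x : ℝ, u x = a + b * x + ∑ i : Fin m, c i * max (x - k i) 0

end MOT

open Filter Topology

namespace MOT

lemma InS.const (a : ℝ) : InS fun _ => a :=
  ⟨a, 0, 0, Fin.elim0, Fin.elim0, fun x => by simp⟩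

lemma InS.call (k : ℝ) : InS fun x => max (x - k) 0 :=
  ⟨0, 0, 1, fun _ => 1, fun _ => k, fun x => by simp⟩

lemma InS.add {u v : ℝ → ℝ} (hu : InS u) (hv : InS v) : InS fun x => u x + v x := by
  obtain ⟨a, b, m, c, k, h⟩ := hu
  obtain ⟨a₂, b₂, m₂, c₂, k₂, h₂⟩ := hv
  refine ⟨a + a₂, b + b₂, m + m₂, Fin.append c c₂, Fin.append k k₂, fun x => ?_⟩
  simp only [h, h₂, Fin.sum_univ_add, Fin.append_left, Fin.append_right]
  ring

lemma InS.const_mul {u : ℝ → ℝ} (r : ℝ) (hu : InS u) : InS fun x => r * u x := by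
  obtain ⟨a, b, m, c, k, h⟩ := hu
  refine ⟨r * a, r * b, m, fun i => r * c i, k, fun x => ?_⟩
  simp only [h, mul_add, Finset.mul_sum, mul_assoc]

lemma InS.sum {u : ℕ → ℝ → ℝ} (hu : ∀ i, InS (u i)) (n : ℕ) :
    InS fun x => ∑ i ∈ Finset.range n, u i x := by
  induction n with
  | zero => simpa using InS.const 0
  | succ n ih => simpa only [Finset.sum_range_succ] using ih.add (hu n)

lemma InS.continuous {u : ℝ → ℝ} (hu : InS u) : Continuous u := by
  obtain ⟨a, b, m, c, k, h⟩ := hu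
  rw [funext h]
  fun_prop

/-- The ramp rising linearly from `0` at `-h` to `1` at `0`. -/
def ramp (h t : ℝ) : ℝ := (max (t + h) 0 - max t 0) / h

/-- The tent of height `1` supported on `[-h, h]`. -/
def hat (h t : ℝ) : ℝ := ramp h t - ramp h (t - h)

lemma ramp_nonneg {h : ℝ} (hh : 0 < h) (t : ℝ) : 0 ≤ ramp h t :=
  div_nonneg (sub_nonneg.2 (max_le_max_right 0 (by linarith))) hh.le

lemma ramp_le_one {h : ℝ} (hh : 0 < h) (t : ℝ) : ramp h t ≤ 1 := by
  rw [ramp, div_le_one hh]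
  rcases max_cases (t + h) 0 with h1 | h1 <;> rcases max_cases t 0 with h2 | h2 <;> linarith

lemma ramp_of_nonneg {h t : ℝ} (hh : 0 < h) (ht : 0 ≤ t) : ramp h t = 1 := by
  rw [ramp, max_eq_left ht, max_eq_left (by linarith), add_sub_cancel_left, div_self hh.ne']

lemma ramp_of_le_neg {h t : ℝ} (hh : 0 < h) (ht : t ≤ -h) : ramp h t = 0 := by
  rw [ramp, max_eq_right (by linarith), max_eq_right (by linarith), sub_self, zero_div]

lemma hat_nonneg {h : ℝ} (hh : 0 < h) (t : ℝ) : 0 ≤ hat h t := by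
  rcases le_total t 0 with ht | ht
  · rw [hat, ramp_of_le_neg (t := t - h) hh (by linarith), sub_zero]
    exact ramp_nonneg hh t
  · rw [hat, ramp_of_nonneg hh ht]
    linarith [ramp_le_one hh (t - h)]

lemma hat_eq_zero {h t : ℝ} (hh : 0 < h) (ht : h < |t|) : hat h t = 0 := by
  rcases lt_abs.1 ht with ht | ht
  · rw [hat, ramp_of_nonneg hh (by linarith), ramp_of_nonneg hh (by linarith), sub_self]
  · rw [hat, ramp_of_le_neg hh (by linarith), ramp_of_le_neg hh (by linarith), sub_self]

lemma sum_hat (h t : ℝ) (n : ℕ) :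
    ∑ i ∈ Finset.range n, hat h (t - i * h) = ramp h t - ramp h (t - n * h) := by
  have := Finset.sum_range_sub' (fun i : ℕ => ramp h (t - i * h)) n
  simp only [Nat.cast_zero, zero_mul, sub_zero] at this
  rw [← this]
  refine Finset.sum_congr rfl fun i _ => ?_
  rw [hat, Nat.cast_succ, add_one_mul, sub_sub]

lemma InS.ramp (h k : ℝ) : InS fun x => ramp h (x - k) := by
  convert ((InS.call (k - h)).add ((InS.call k).const_mul (-1))).const_mul h⁻¹ using 2 with x
  rw [MOT.ramp, ← sub_add]
  ring

lemma InS.hat (h k : ℝ) : InS fun x => hat h (x - k) := by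
  convert (InS.ramp h k).add ((InS.ramp h (k + h)).const_mul (-1)) using 2 with x
  rw [MOT.hat, ← sub_sub]
  ring

/-- A continuous function `f ≥ -C` has a minorant in `𝒮`, bounded below by `-C`, which on `[-R, R]`
is at least the minimum of `f` over a neighbourhood of radius `2 * h`. -/
lemma exists_minorant {f : ℝ → ℝ} (hf : Continuous f) {C : ℝ} (hC : ∀ x, -C ≤ f x)
    {h : ℝ} (hh : 0 < h) (R : ℝ) :
    ∃ u : ℝ → ℝ, InS u ∧ (∀ x, u x ≤ f x) ∧ (∀ x, -C ≤ u x) ∧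
      ∀ x, |x| ≤ R → ∀ a, (∀ y, |y - x| ≤ 2 * h → a ≤ f y) → a ≤ u x := by
  have hmin (k : ℝ) : ∃ y, |y - k| ≤ h ∧ ∀ x, |x - k| ≤ h → f y ≤ f x := by
    obtain ⟨y, hy, hmin⟩ := (isCompact_closedBall k h).exists_isMinOn
      (Metric.nonempty_closedBall.2 hh.le) hf.continuousOn
    exact ⟨y, hy, fun x hx => hmin hx⟩
  choose y hyk hy using hmin
  let k (i : ℕ) : ℝ := -R + i * h
  obtain ⟨n, hn⟩ := exists_nat_ge (2 * R / h)
  rw [div_le_iff₀ hh] at hn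
  have hsum (x : ℝ) : ∑ i ∈ Finset.range (n + 1), hat h (x - k i)
      = ramp h (x + R) - ramp h (x + R - (n + 1 : ℕ) * h) := by
    rw [← sum_hat]
    refine Finset.sum_congr rfl fun i _ => ?_
    congr 1
    simp only [k]
    ring
  refine ⟨fun x => -C + ∑ i ∈ Finset.range (n + 1), (f (y (k i)) + C) * hat h (x - k i),
    (InS.const _).add (InS.sum (fun i => (InS.hat h (k i)).const_mul _) _), fun x => ?_,
    fun x => ?_, fun x hx a ha => ?_⟩
  · have hle : ∑ i ∈ Finset.range (n + 1), (f (y (k i)) + C) * hat h (x - k i)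
        ≤ ∑ i ∈ Finset.range (n + 1), (f x + C) * hat h (x - k i) := by
      refine Finset.sum_le_sum fun i _ => ?_
      rcases le_or_gt |x - k i| h with hi | hi
      · exact mul_le_mul_of_nonneg_right (by linarith [hy _ x hi]) (hat_nonneg hh _)
      · simp [hat_eq_zero hh hi]
    rw [← Finset.mul_sum, hsum] at hle
    have := mul_le_of_le_one_right (by linarith [hC x] : 0 ≤ f x + C)
      (by linarith [ramp_le_one hh (x + R), ramp_nonneg hh (x + R - (n + 1 : ℕ) * h)] :
        ramp h (x + R) - ramp h (x + R - (n + 1 : ℕ) * h) ≤ 1)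
    linarith
  · have : 0 ≤ ∑ i ∈ Finset.range (n + 1), (f (y (k i)) + C) * hat h (x - k i) :=
      Finset.sum_nonneg fun i _ =>
        mul_nonneg (by linarith [hC (y (k i))]) (hat_nonneg hh _)
    linarith
  · have hle : ∑ i ∈ Finset.range (n + 1), (a + C) * hat h (x - k i)
        ≤ ∑ i ∈ Finset.range (n + 1), (f (y (k i)) + C) * hat h (x - k i) := by
      refine Finset.sum_le_sum fun i _ => ?_
      rcases le_or_gt |x - k i| h with hi | hi
      · refine mul_le_mul_of_nonneg_right ?_ (hat_nonneg hh _)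
        have := ha (y (k i)) (by
          have := abs_sub_le (y (k i)) (k i) x
          rw [abs_sub_comm (k i) x] at this
          linarith [hyk (k i)])
        linarith
      · simp [hat_eq_zero hh hi]
    obtain ⟨hx1, hx2⟩ := abs_le.1 hx
    rw [← Finset.mul_sum, hsum, ramp_of_nonneg hh (by linarith),
      ramp_of_le_neg hh (by push_cast; linarith)] at hle
    linarith

end MOT

/-- **Approximation from below by call portfolios.** For a bounded continuous
`f : ℝ → ℝ`, a Borel probability measure `μ` on `ℝ` with finite first moment and `ε > 0`,
there is `u ∈ 𝒮` with `u ≤ f` pointwise and `∫ (f - u) dμ < ε`. -/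
theorem call_approximation (f : ℝ → ℝ) (hf : Continuous f) (hfb : ∃ C, ∀ x, |f x| ≤ C)
    (μ : Measure ℝ) (hprob : IsProbabilityMeasure μ)
    (hmom : Integrable (fun x : ℝ => x) μ)
    (ε : ℝ) (hε : 0 < ε) :
    ∃ u : ℝ → ℝ, MOT.InS u ∧ (∀ x, u x ≤ f x) ∧ ∫ x, (f x - u x) ∂μ < ε := by
  obtain ⟨C, hC⟩ := hfb
  choose u hu huf huC hua using fun n : ℕ =>
    MOT.exists_minorant hf (fun x => (abs_le.1 (hC x)).1)
      (Nat.one_div_pos_of_nat (α := ℝ) (n := n)) (n : ℝ)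
  have hlim : Tendsto (fun n => ∫ x, (f x - u n x) ∂μ) atTop (𝓝 (∫ _, (0 : ℝ) ∂μ)) := by
    refine tendsto_integral_of_dominated_convergence (fun _ => 2 * C)
      (fun n => (hf.sub (hu n).continuous).aestronglyMeasurable) (integrable_const _)
      (fun n => ae_of_all _ fun x => ?_) (ae_of_all _ fun x => ?_)
    · rw [Real.norm_of_nonneg (sub_nonneg.2 (huf n x))]
      linarith [huC n x, (abs_le.1 (hC x)).2]
    · rw [Metric.tendsto_atTop']
      intro δ hδ
      obtain ⟨r, hr, hfr⟩ := Metric.continuous_iff.1 hf x (δ / 2) (half_pos hδ)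
      obtain ⟨N, hN⟩ := exists_nat_one_div_lt (half_pos hr)
      obtain ⟨M, hM⟩ := exists_nat_ge |x|
      refine ⟨max N M, fun n hn => ?_⟩
      have hnN : 1 / ((n : ℝ) + 1) ≤ 1 / ((N : ℝ) + 1) :=
        Nat.one_div_le_one_div ((le_max_left _ _).trans hn.le)
      have hnM : (M : ℝ) ≤ n := Nat.cast_le.2 ((le_max_right _ _).trans hn.le)
      have := hua n x (hM.trans hnM) (f x - δ / 2) fun y hy => by
        have := hfr y (by rw [Real.dist_eq]; linarith)
        rw [Real.dist_eq] at this
        linarith [(abs_lt.1 this).1]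
      rw [Real.dist_eq, sub_zero, abs_of_nonneg (sub_nonneg.2 (huf n x))]
      linarith
  rw [integral_zero] at hlim
  obtain ⟨n, hn⟩ := (hlim.eventually_lt_const hε).exists
  exact ⟨u n, hu n, huf n, hn⟩
end
end
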